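/- Let k be an algebraically closed field of characteristic 0, q ∈ k^× and G ∈ ℕ with G ≥ 1. In the free algebra k⟨x_1,x_2,x_3⟩ define x_21 := x_2x_1 + x_1x_2, z_0 := x_3 and z_{t+1} := x_2·z_t − (−1)^t·q·z_t·x_2 for t ≥ 0. Let A be the quotient of k⟨x_1,x_2,x_3⟩ by the two-sided ideal generated by: x_1², x_2x_21 − x_21x_2 − x_1x_21, x_1x_3 − q·x_3x_1, x_21x_3 − q²·x_3x_21, z_{2G+1}, z_{2k+1}² for 0 ≤ k < G, and z_{2k}·z_{2k+1} − q^{−1}·z_{2k+1}·z_{2k} for 0 ≤ k < G. Then the images of the monomials x_1^{m_1}·x_21^{m_2}·x_2^{m_3}·z_{2G}^{n_{2G}}·⋯·z_1^{n_1}·z_0^{n_0}, with m_1 ∈ {0,1}, n_{2k+1} ∈ {0,1}, and m_2, m_3, n_{2k} ∈ ℕ, form a k-basis of A, and GKdim A = G + 3. (A is the Nichols algebra B(lstr_−(1,G)) of a super Jordan block, a point with label 1, weak interaction and discrete ghost G.) -/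

import Mathlib

open scoped ENNReal

/-- The Gelfand–Kirillov dimension of a `k`-algebra `A`. -/
noncomputable def GKdim (k A : Type*) [Field k] [Ring A] [Algebra k A] : ℝ≥0∞ :=
  ⨆ (V : Submodule k A) (_ : FiniteDimensional k V),
    Filter.limsup
      (fun n : ℕ =>
        ENNReal.ofReal
          (Real.log ((Module.finrank k (↥(∑ j ∈ Finset.range (n + 1), V ^ j)) : ℕ) : ℝ) /
            Real.log (n : ℝ)))
      Filter.atTop

/-- The generator `x_{i+1}` of the free algebra `k⟨x₁,x₂,x₃⟩`. -/
noncomputable def X (k : Type*) [Field k] (i : Fin 3) : FreeAlgebra k (Fin 3) :=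
  FreeAlgebra.ι k i

/-- `x₂₁ := x₂x₁ + x₁x₂`. -/
noncomputable def x21 (k : Type*) [Field k] : FreeAlgebra k (Fin 3) :=
  X k 1 * X k 0 + X k 0 * X k 1

/-- `z₀ := x₃`, `z_{t+1} := x₂ z_t − (−1)^t q z_t x₂`. -/
noncomputable def z (k : Type*) [Field k] (q : k) : ℕ → FreeAlgebra k (Fin 3)
  | 0 => X k 2
  | (t + 1) => X k 1 * z k q t - ((-1 : k) ^ t * q) • (z k q t * X k 1)

/-- The defining relations of `B(lstr₋(1,G))`. -/
def lstrRel (k : Type*) [Field k] (q : k) (G : ℕ)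
    (a b : FreeAlgebra k (Fin 3)) : Prop :=
  b = 0 ∧
    (a = X k 0 * X k 0 ∨
     a = X k 1 * x21 k - x21 k * X k 1 - X k 0 * x21 k ∨
     a = X k 0 * X k 2 - q • (X k 2 * X k 0) ∨
     a = x21 k * X k 2 - (q ^ 2) • (X k 2 * x21 k) ∨
     a = z k q (2 * G + 1) ∨
     (∃ j < G, a = z k q (2 * j + 1) * z k q (2 * j + 1)) ∨
     (∃ j < G, a = z k q (2 * j) * z k q (2 * j + 1) -
        q⁻¹ • (z k q (2 * j + 1) * z k q (2 * j))))

/-- The PBW monomials `x₁^{m₁} x₂₁^{m₂} x₂^{m₃} z_{2G}^{n_{2G}} ⋯ z₀^{n₀}`, where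
`m₁ ∈ {0,1}` and the exponents of the odd-indexed `z`'s lie in `{0,1}`. -/
noncomputable def bas (k : Type*) [Field k] (q : k) (G : ℕ)
    (p : Fin 2 × ℕ × ℕ ×
      {n : Fin (2 * G + 1) → ℕ // ∀ t : Fin (2 * G + 1), (t : ℕ) % 2 = 1 → n t ≤ 1}) :
    RingQuot (lstrRel k q G) :=
  RingQuot.mkAlgHom k (lstrRel k q G)
    (X k 0 ^ ((p.1 : ℕ)) * x21 k ^ p.2.1 * X k 1 ^ p.2.2.1 *
      ((List.ofFn fun t : Fin (2 * G + 1) => z k q (t : ℕ) ^ p.2.2.2.1 t).reverse).prod)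

/-- Elements `x₁`, `x₂`, `z_t` of a `k`-algebra satisfying the defining relations of
`B(lstr₋(1,G))`. -/
structure IsLstr {k A : Type*} [Field k] [Ring A] [Algebra k A] (q : k) (G : ℕ)
    (x₁ x₂ : A) (Z : ℕ → A) : Prop where
  sq : x₁ * x₁ = 0
  jordan : x₂ * (x₂ * x₁ + x₁ * x₂) =
    (x₂ * x₁ + x₁ * x₂) * x₂ + x₁ * (x₂ * x₁ + x₁ * x₂)
  x₁_z₀ : x₁ * Z 0 = q • (Z 0 * x₁)
  x₂₁_z₀ : (x₂ * x₁ + x₁ * x₂) * Z 0 = (q ^ 2) • (Z 0 * (x₂ * x₁ + x₁ * x₂))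
  z_succ : ∀ t, x₂ * Z t = Z (t + 1) + ((-1 : k) ^ t * q) • (Z t * x₂)
  z_top : Z (2 * G + 1) = 0
  z_sq : ∀ j < G, Z (2 * j + 1) * Z (2 * j + 1) = 0
  z_comm : ∀ j < G, Z (2 * j) * Z (2 * j + 1) = q⁻¹ • (Z (2 * j + 1) * Z (2 * j))

/-- The product `Z_{m-1} ^ n_{m-1} ⋯ Z₀ ^ n₀`. -/
def descProd {A : Type*} [Monoid A] (Z : ℕ → A) : ℕ → (ℕ → ℕ) → A
  | 0, _ => 1
  | (m + 1), n => Z m ^ n m * descProd Z m n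

theorem descProd_congr {A : Type*} [Monoid A] (Z : ℕ → A) {m : ℕ} {n n' : ℕ → ℕ}
    (h : ∀ t < m, n t = n' t) : descProd Z m n = descProd Z m n' := by
  induction m with
  | zero => rfl
  | succ m ih =>
    simp only [descProd]
    rw [h m (by omega), ih fun t ht => h t (by omega)]

theorem prod_reverse_ofFn_pow {A : Type*} [Monoid A] (Z : ℕ → A) (m : ℕ) (n : ℕ → ℕ) :
    ((List.ofFn fun t : Fin m => Z t ^ n t).reverse).prod = descProd Z m n := by
  induction m with
  | zero => simp [descProd]
  | succ m ih =>
    rw [List.ofFn_succ', List.concat_eq_append, List.reverse_append]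
    rw [List.reverse_singleton, List.singleton_append, List.prod_cons]
    simp only [descProd, Fin.val_last]
    rw [← ih]
    rfl

theorem descProd_eq_zero {A : Type*} [MonoidWithZero A] (Z : ℕ → A) {m t : ℕ} (ht : t < m)
    {n : ℕ → ℕ} (h : Z t ^ n t = 0) : descProd Z m n = 0 := by
  induction m with
  | zero => omega
  | succ m ih =>
    simp only [descProd]
    rcases Nat.lt_succ_iff_lt_or_eq.mp ht with ht | rfl
    · rw [ih ht, mul_zero]
    · rw [h, zero_mul]

theorem map_descProd {A B : Type*} [Monoid A] [Monoid B] (f : A →* B) (Z : ℕ → A) (m : ℕ)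
    (n : ℕ → ℕ) : f (descProd Z m n) = descProd (fun t => f (Z t)) m n := by
  induction m with
  | zero => simp [descProd]
  | succ m ih => simp [descProd, ih]

theorem exists_mul_pow_eq_smul {k A : Type*} [Field k] [Ring A] [Algebra k A] {a b : A} {c : k}
    (h : a * b = c • (b * a)) (m : ℕ) : a * b ^ m = c ^ m • (b ^ m * a) := by
  induction m with
  | zero => simp
  | succ m ih =>
    rw [pow_succ, ← mul_assoc, ih, smul_mul_assoc, mul_assoc, h, mul_smul_comm, smul_smul,
      mul_assoc, pow_succ]

namespace IsLstr

variable {k A : Type*} [Field k] [Ring A] [Algebra k A] {q : k} {G : ℕ} {x₁ x₂ : A} {Z : ℕ → A}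

theorem x₁_mul_x₂₁ (h : IsLstr q G x₁ x₂ Z) :
    x₁ * (x₂ * x₁ + x₁ * x₂) = (x₂ * x₁ + x₁ * x₂) * x₁ := by
  have := h.sq
  rw [mul_add, add_mul, ← mul_assoc x₁ x₁, this, mul_assoc x₂, this, mul_assoc]
  simp

theorem x₁_x₂₁_z (h : IsLstr q G x₁ x₂ Z) (t : ℕ) :
    x₁ * Z t = ((-1 : k) ^ t * q) • (Z t * x₁) ∧
      (x₂ * x₁ + x₁ * x₂) * Z t = (q ^ 2) • (Z t * (x₂ * x₁ + x₁ * x₂)) := by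
  induction t with
  | zero => exact ⟨by simpa using h.x₁_z₀, h.x₂₁_z₀⟩
  | succ t ih =>
    obtain ⟨h1, h2⟩ := ih
    have hj := h.jordan
    obtain ⟨w, hw⟩ : ∃ w, w = x₂ * x₁ + x₁ * x₂ := ⟨_, rfl⟩
    have hx : x₁ * x₂ = w - x₂ * x₁ := by rw [hw]; abel
    rw [← hw] at h2 hj ⊢
    have hj' : w * x₂ = x₂ * w - x₁ * w := by rw [hj]; abel
    have hz : Z (t + 1) = x₂ * Z t - ((-1 : k) ^ t * q) • (Z t * x₂) := by
      rw [h.z_succ]; abel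
    constructor
    · have : x₁ * Z (t + 1) = w * Z t - x₂ * (x₁ * Z t) -
          ((-1 : k) ^ t * q) • ((x₁ * Z t) * x₂) := by
        rw [hz, mul_sub, ← mul_assoc, hx, mul_smul_comm, sub_mul, mul_assoc, mul_assoc]
      rw [this, h2, h1, hz, hw]
      rcases neg_one_pow_eq_or k t with e | e <;>
      · simp only [e, pow_succ (-1 : k) t, mul_add, sub_mul, mul_smul_comm, smul_mul_assoc,
          smul_smul, mul_assoc, smul_add, smul_sub]
        match_scalars <;> ring
    · have e1 : w * Z (t + 1) = x₂ * (w * Z t) - x₁ * (w * Z t) -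
          ((-1 : k) ^ t * q) • ((w * Z t) * x₂) := by
        rw [hz, mul_sub, ← mul_assoc, hj', mul_smul_comm, sub_mul, mul_assoc, mul_assoc, mul_assoc]
      have e2 : x₁ * (Z t * w) = ((-1 : k) ^ t * q) • (Z t * (x₁ * w)) := by
        rw [← mul_assoc, h1, smul_mul_assoc, mul_assoc]
      have e3 : Z t * w * x₂ = Z t * (x₂ * w) - Z t * (x₁ * w) := by
        rw [mul_assoc, hj', mul_sub]
      rw [e1, h2, mul_smul_comm, mul_smul_comm, smul_mul_assoc, e2, e3, hz]
      simp only [sub_mul, smul_mul_assoc, mul_assoc]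
      match_scalars <;> ring

theorem z_eq_zero (h : IsLstr q G x₁ x₂ Z) {t : ℕ} (ht : 2 * G < t) : Z t = 0 := by
  induction t, ht using Nat.le_induction with
  | base => exact h.z_top
  | succ t _ ih => simpa [ih] using (h.z_succ t).symm

theorem z_mul_z_succ (h : IsLstr q G x₁ x₂ Z) (t s : ℕ)
    (h1 : (q ^ s) • (Z t * Z s) = ((-1 : k) ^ (t * s) * q ^ t) • (Z s * Z t)) :
    (q ^ s) • (Z (t + 1) * Z s) + ((-1 : k) ^ t * q ^ (s + 1)) • (Z t * Z (s + 1)) =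
      ((-1 : k) ^ (t * s) * q ^ t) • (Z (s + 1) * Z t) +
      ((-1 : k) ^ (t * s + s) * q ^ (t + 1)) • (Z s * Z (t + 1)) := by
  have key : ∀ a b, x₂ * (Z a * Z b) = Z (a + 1) * Z b + ((-1 : k) ^ a * q) • (Z a * Z (b + 1)) +
      ((-1 : k) ^ (a + b) * q ^ 2) • (Z a * Z b * x₂) := by
    intro a b
    rw [← mul_assoc, h.z_succ, add_mul, smul_mul_assoc, mul_assoc (Z a) x₂, h.z_succ b, mul_add,
      smul_add, mul_smul_comm, smul_smul, add_assoc, mul_assoc (Z a)]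
    congr 3
    ring
  have h2 := congrArg (fun y => x₂ * y) h1
  have h3 := congrArg (fun y => ((-1 : k) ^ (t + s) * q ^ 2) • (y * x₂)) h1
  simp only [mul_smul_comm, key, smul_mul_assoc] at h2 h3
  rw [add_comm s t] at h2
  have h4 := congrArg₂ (fun y y' => y - y') h2 h3
  simp only [smul_add] at h4
  refine Eq.trans ?_ (h4.trans ?_)
  · match_scalars <;> ring
  · match_scalars <;> ring

theorem z_mul_z_add [CharZero k] (h : IsLstr q G x₁ x₂ Z) (hq : q ≠ 0) (d : ℕ) : ∀ t,
    (q ^ (t + d)) • (Z t * Z (t + d)) =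
      ((-1 : k) ^ (t * (t + d)) * q ^ t) • (Z (t + d) * Z t) := by
  have h0 : ∀ t, (q ^ t) • (Z t * Z t) = ((-1 : k) ^ (t * t) * q ^ t) • (Z t * Z t) := by
    intro t
    rcases Nat.even_or_odd' t with ⟨j, rfl | rfl⟩
    · rw [show 2 * j * (2 * j) = 2 * (j * (2 * j)) by ring, pow_mul (-1 : k)]
      simp
    · have : Z (2 * j + 1) * Z (2 * j + 1) = 0 := by
        by_cases hj : j < G
        · exact h.z_sq j hj
        · rw [h.z_eq_zero (by omega), zero_mul]
      simp [this]
  have h1 : ∀ t, (q ^ (t + 1)) • (Z t * Z (t + 1)) = q ^ t • (Z (t + 1) * Z t) := by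
    intro t
    rcases Nat.even_or_odd' t with ⟨j, rfl | rfl⟩
    · by_cases hj : j < G
      · rw [h.z_comm j hj, smul_smul, pow_succ, mul_assoc, mul_inv_cancel₀ hq, mul_one]
      · rw [h.z_eq_zero (t := 2 * j + 1) (by omega)]
        simp
    · have := h.z_mul_z_succ _ _ (h0 (2 * j + 1))
      have e1 : (-1 : k) ^ (2 * j + 1) = -1 := by rw [pow_succ, pow_mul]; simp
      have e2 : (-1 : k) ^ ((2 * j + 1) * (2 * j + 1)) = -1 := by rw [pow_mul, e1, e1]
      rw [pow_add (-1 : k) ((2 * j + 1) * (2 * j + 1)), e2, e1] at this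
      have h4 : (2 : k) • ((q ^ (2 * j + 1 + 1)) • (Z (2 * j + 1) * Z (2 * j + 1 + 1))) =
          (2 : k) • (q ^ (2 * j + 1) • (Z (2 * j + 1 + 1) * Z (2 * j + 1))) := by
        have h5 := sub_eq_zero.mpr this
        refine sub_eq_zero.mp (Eq.trans ?_ (neg_eq_zero.mpr h5))
        match_scalars <;> ring
      exact smul_right_injective A (two_ne_zero (α := k)) h4
  induction d using Nat.strong_induction_on with
  | _ d ih =>
    intro t
    match d with
    | 0 => simpa using h0 t
    | 1 =>
      rw [h1, Nat.even_mul_succ_self t |>.neg_one_pow, one_mul]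
    | d + 2 =>
      have e1 := h.z_mul_z_succ _ _ (ih (d + 1) (by omega) t)
      have e2 := ih d (by omega) (t + 1)
      rw [show t + 1 + d = t + (d + 1) by ring] at e2
      rw [e2, show (t + 1) * (t + (d + 1)) = t * (t + (d + 1)) + (t + (d + 1)) by ring, add_comm,
        add_left_inj] at e1
      have e3 := congrArg (fun y => (-1 : k) ^ t • y) e1
      simp only [smul_smul] at e3
      rw [show t + (d + 2) = t + (d + 1) + 1 by ring]
      rw [show t * (t + (d + 1) + 1) = t + t * (t + (d + 1)) by ring]
      rcases neg_one_pow_eq_or k t with e | e <;>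
      · rw [e] at e3
        rw [pow_add (-1 : k), e]
        simpa using e3

theorem exists_z_mul_z [CharZero k] (h : IsLstr q G x₁ x₂ Z) (hq : q ≠ 0) (t s : ℕ) :
    ∃ c : k, Z t * Z s = c • (Z s * Z t) := by
  rcases le_total t s with hts | hts
  · obtain ⟨d, rfl⟩ := Nat.exists_eq_add_of_le hts
    refine ⟨(q ^ (t + d))⁻¹ * ((-1 : k) ^ (t * (t + d)) * q ^ t), ?_⟩
    rw [mul_smul, ← h.z_mul_z_add hq, inv_smul_smul₀ (pow_ne_zero _ hq)]
  · obtain ⟨d, rfl⟩ := Nat.exists_eq_add_of_le hts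
    have hc : (-1 : k) ^ (s * (s + d)) * q ^ s ≠ 0 :=
      mul_ne_zero (pow_ne_zero _ (by simp)) (pow_ne_zero _ hq)
    refine ⟨((-1 : k) ^ (s * (s + d)) * q ^ s)⁻¹ * q ^ (s + d), ?_⟩
    rw [mul_smul, h.z_mul_z_add hq, inv_smul_smul₀ hc]

theorem exists_z_mul_descProd [CharZero k] (h : IsLstr q G x₁ x₂ Z) (hq : q ≠ 0) {t m : ℕ}
    (ht : t < m) (n : ℕ → ℕ) :
    ∃ c : k, Z t * descProd Z m n = c • descProd Z m (Function.update n t (n t + 1)) := by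
  induction m with
  | zero => omega
  | succ m ih =>
    simp only [descProd]
    rcases Nat.lt_succ_iff_lt_or_eq.mp ht with ht | rfl
    · obtain ⟨c, hc⟩ := ih ht
      obtain ⟨d, hd⟩ := h.exists_z_mul_z hq t m
      refine ⟨d ^ n m * c, ?_⟩
      rw [← mul_assoc, exists_mul_pow_eq_smul hd, Function.update_of_ne (by omega), smul_mul_assoc,
        mul_assoc, hc, mul_smul_comm, smul_smul]
    · refine ⟨1, ?_⟩
      rw [Function.update_self, one_smul, pow_succ', mul_assoc,
        descProd_congr Z (n := Function.update n t (n t + 1)) (n' := n) fun s hs =>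
          Function.update_of_ne (ne_of_lt hs) _ _]

theorem pow_eq_zero_of_odd (h : IsLstr q G x₁ x₂ Z) {t m : ℕ} (ht : t % 2 = 1) (hm : 2 ≤ m) :
    Z t ^ m = 0 := by
  obtain ⟨m, rfl⟩ := Nat.exists_eq_add_of_le hm
  have : Z t * Z t = 0 := by
    by_cases hG : 2 * G < t
    · rw [h.z_eq_zero hG, zero_mul]
    · have := h.z_sq (t / 2) (by omega)
      rwa [show 2 * (t / 2) + 1 = t by omega] at this
  rw [pow_add, pow_two, this, zero_mul]

end IsLstr

/-- The span of the ordered monomials whose exponents of `x₂₁`, `x₂` and the even-indexed `z`'s are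
at most `N`. -/
def boxSpan (k : Type*) {A : Type*} [Field k] [Ring A] [Algebra k A] (G : ℕ) (x₁ x₂ : A)
    (Z : ℕ → A) (N : ℕ) : Submodule k A :=
  Submodule.span k {y | ∃ (a b c : ℕ) (n : ℕ → ℕ), b ≤ N ∧ c ≤ N ∧ (∀ t, t % 2 = 0 → n t ≤ N) ∧
    y = x₁ ^ a * (x₂ * x₁ + x₁ * x₂) ^ b * x₂ ^ c * descProd Z (2 * G + 1) n}

section boxSpan

variable {k A : Type*} [Field k] [Ring A] [Algebra k A] {q : k} {G : ℕ} {x₁ x₂ : A} {Z : ℕ → A}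

theorem mem_boxSpan {N a b c : ℕ} {n : ℕ → ℕ} (hb : b ≤ N) (hc : c ≤ N)
    (hn : ∀ t, t % 2 = 0 → n t ≤ N) :
    x₁ ^ a * (x₂ * x₁ + x₁ * x₂) ^ b * x₂ ^ c * descProd Z (2 * G + 1) n ∈
      boxSpan k G x₁ x₂ Z N :=
  Submodule.subset_span ⟨a, b, c, n, hb, hc, hn, rfl⟩

theorem boxSpan_mono : Monotone (boxSpan k G x₁ x₂ Z) := by
  rintro N N' h
  refine Submodule.span_mono ?_
  rintro _ ⟨a, b, c, n, hb, hc, hn, rfl⟩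
  exact ⟨a, b, c, n, hb.trans h, hc.trans h, fun t ht => (hn t ht).trans h, rfl⟩

theorem one_mem_boxSpan (N : ℕ) : 1 ∈ boxSpan k G x₁ x₂ Z N := by
  have h0 : ∀ m, descProd Z m 0 = 1 := fun m => by
    induction m with
    | zero => rfl
    | succ m ih => simp [descProd, ih]
  have := mem_boxSpan (k := k) (G := G) (x₁ := x₁) (x₂ := x₂) (Z := Z) (a := 0) (b := 0) (c := 0)
    (n := 0) (Nat.zero_le N) (Nat.zero_le N) (fun _ _ => Nat.zero_le _)
  simpa [h0] using this

theorem mul_mem_of_forall_monomial {u : A} {N : ℕ} {M : Submodule k A}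
    (h : ∀ (a b c : ℕ) (n : ℕ → ℕ), b ≤ N → c ≤ N → (∀ t, t % 2 = 0 → n t ≤ N) →
      u * (x₁ ^ a * (x₂ * x₁ + x₁ * x₂) ^ b * x₂ ^ c * descProd Z (2 * G + 1) n) ∈ M)
    {v : A} (hv : v ∈ boxSpan k G x₁ x₂ Z N) : u * v ∈ M := by
  have : boxSpan k G x₁ x₂ Z N ≤ M.comap (LinearMap.mulLeft k u) := by
    refine Submodule.span_le.mpr ?_
    rintro _ ⟨a, b, c, n, hb, hc, hn, rfl⟩
    exact h a b c n hb hc hn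
  exact this hv

namespace IsLstr

theorem x₁_mul_mem {N : ℕ} {v : A} (hv : v ∈ boxSpan k G x₁ x₂ Z N) :
    x₁ * v ∈ boxSpan k G x₁ x₂ Z (N + 1) := by
  refine mul_mem_of_forall_monomial (fun a b c n hb hc hn => ?_) hv
  rw [← mul_assoc, ← mul_assoc, ← mul_assoc, ← pow_succ']
  exact mem_boxSpan (by omega) (by omega) fun t ht => (hn t ht).trans (by omega)

theorem x₂_mul_x₂₁_pow (h : IsLstr q G x₁ x₂ Z) (b : ℕ) :
    x₂ * (x₂ * x₁ + x₁ * x₂) ^ b = (x₂ * x₁ + x₁ * x₂) ^ b * x₂ +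
      (b : k) • (x₁ * (x₂ * x₁ + x₁ * x₂) ^ b) := by
  have h1 := h.x₁_mul_x₂₁
  have h2 := h.jordan
  generalize x₂ * x₁ + x₁ * x₂ = w at *
  induction b with
  | zero => simp
  | succ b ih =>
    rw [pow_succ, ← mul_assoc, ih, add_mul, mul_assoc _ x₂, h2, mul_add, ← mul_assoc, ← mul_assoc,
      (show Commute x₁ w from h1).pow_right b |>.eq, smul_mul_assoc, mul_assoc _ x₁ w]
    push_cast
    rw [add_smul, one_smul, mul_assoc _ w, add_assoc, add_comm ((b : k) • _), ← mul_assoc x₁,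
      (show Commute x₁ w from h1).pow_right b |>.eq, mul_assoc]

theorem x₂_mul_mem (h : IsLstr q G x₁ x₂ Z) {N : ℕ} {v : A}
    (hv : v ∈ boxSpan k G x₁ x₂ Z N) : x₂ * v ∈ boxSpan k G x₁ x₂ Z (N + 1) := by
  refine mul_mem_of_forall_monomial (fun a b c n hb hc hn => ?_) hv
  have hn' : ∀ t, t % 2 = 0 → n t ≤ N + 1 := fun t ht => (hn t ht).trans (by omega)
  have e := h.x₂_mul_x₂₁_pow b
  match a with
  | 0 =>
    have : x₂ * (x₁ ^ 0 * (x₂ * x₁ + x₁ * x₂) ^ b * x₂ ^ c * descProd Z (2 * G + 1) n) =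
        x₁ ^ 0 * (x₂ * x₁ + x₁ * x₂) ^ b * x₂ ^ (c + 1) * descProd Z (2 * G + 1) n +
        (b : k) • (x₁ ^ 1 * (x₂ * x₁ + x₁ * x₂) ^ b * x₂ ^ c * descProd Z (2 * G + 1) n) := by
      rw [pow_zero, one_mul, ← mul_assoc, ← mul_assoc, e]
      simp only [add_mul, smul_mul_assoc, pow_succ', mul_assoc, pow_zero, mul_one]
    rw [this]
    exact add_mem (mem_boxSpan (by omega) (by omega) hn')
      (Submodule.smul_mem _ _ (mem_boxSpan (by omega) (by omega) hn'))
  | 1 =>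
    have hz : x₁ * (x₁ * (x₂ * x₁ + x₁ * x₂) ^ b) = 0 := by rw [← mul_assoc, h.sq, zero_mul]
    have : x₂ * (x₁ ^ 1 * (x₂ * x₁ + x₁ * x₂) ^ b * x₂ ^ c * descProd Z (2 * G + 1) n) =
        x₁ ^ 0 * (x₂ * x₁ + x₁ * x₂) ^ (b + 1) * x₂ ^ c * descProd Z (2 * G + 1) n -
        x₁ ^ 1 * (x₂ * x₁ + x₁ * x₂) ^ b * x₂ ^ (c + 1) * descProd Z (2 * G + 1) n := by
      have e1 : x₂ * (x₁ * (x₂ * x₁ + x₁ * x₂) ^ b) =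
          (x₂ * x₁ + x₁ * x₂) ^ (b + 1) - x₁ * (x₂ * x₁ + x₁ * x₂) ^ b * x₂ := by
        have e2 : x₁ * (x₂ * (x₂ * x₁ + x₁ * x₂) ^ b) = x₁ * (x₂ * x₁ + x₁ * x₂) ^ b * x₂ := by
          rw [e, mul_add, mul_smul_comm, hz, smul_zero, add_zero, mul_assoc]
        rw [← e2, pow_succ' _ b, add_mul, mul_assoc, mul_assoc]
        abel
      rw [pow_zero, one_mul, pow_one, ← mul_assoc, ← mul_assoc, e1, sub_mul, sub_mul,
        pow_succ' x₂ c, mul_assoc _ x₂ (x₂ ^ c)]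
    rw [this]
    exact sub_mem (mem_boxSpan (by omega) (by omega) hn') (mem_boxSpan (by omega) (by omega) hn')
  | a + 2 =>
    have : x₁ ^ (a + 2) = 0 := by rw [pow_add, pow_two, h.sq, mul_zero]
    simp [this]

theorem z_mul_x₂_pow_mem (h : IsLstr q G x₁ x₂ Z) (hq : q ≠ 0) (c : ℕ) : ∀ t, Z t * x₂ ^ c ∈
    Submodule.span k {y | ∃ i ≤ c, ∃ s, y = x₂ ^ i * Z s} := by
  induction c with
  | zero => exact fun t => Submodule.subset_span ⟨0, le_rfl, t, by simp⟩
  | succ c ih =>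
    intro t
    have hu : ((-1 : k) ^ t * q) ≠ 0 := mul_ne_zero (pow_ne_zero _ (by simp)) hq
    have e : Z t * x₂ = ((-1 : k) ^ t * q)⁻¹ • (x₂ * Z t - Z (t + 1)) := by
      rw [h.z_succ, add_sub_cancel_left, inv_smul_smul₀ hu]
    rw [pow_succ', ← mul_assoc, e, smul_mul_assoc, sub_mul, mul_assoc]
    refine Submodule.smul_mem _ _ (sub_mem ?_ ?_)
    · have : Submodule.span k {y | ∃ i ≤ c, ∃ s, y = x₂ ^ i * Z s} ≤
          (Submodule.span k {y | ∃ i ≤ c + 1, ∃ s, y = x₂ ^ i * Z s}).comap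
            (LinearMap.mulLeft k x₂) := by
        refine Submodule.span_le.mpr ?_
        rintro _ ⟨i, hi, s, rfl⟩
        refine Submodule.subset_span ⟨i + 1, by omega, s, ?_⟩
        rw [LinearMap.mulLeft_apply, pow_succ', mul_assoc]
      exact this (ih t)
    · refine Submodule.span_mono ?_ (ih (t + 1))
      rintro _ ⟨i, hi, s, rfl⟩
      exact ⟨i, by omega, s, rfl⟩

theorem z_mul_mem [CharZero k] (h : IsLstr q G x₁ x₂ Z) (hq : q ≠ 0) (t : ℕ) {N : ℕ} {v : A}
    (hv : v ∈ boxSpan k G x₁ x₂ Z N) : Z t * v ∈ boxSpan k G x₁ x₂ Z (N + 1) := by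
  refine mul_mem_of_forall_monomial (fun a b c n hb hc hn => ?_) hv
  obtain ⟨h1, h2⟩ := h.x₁_x₂₁_z t
  have inv : ∀ {u v : A} {c : k}, c ≠ 0 → u * v = c • (v * u) → v * u = c⁻¹ • (u * v) :=
    fun hc e => by rw [e, inv_smul_smul₀ hc]
  have h3 := exists_mul_pow_eq_smul
    (inv (mul_ne_zero (pow_ne_zero t (by simp : (-1 : k) ≠ 0)) hq) h1) a
  have h4 := exists_mul_pow_eq_smul (inv (pow_ne_zero 2 hq) h2) b
  rw [← mul_assoc, ← mul_assoc, ← mul_assoc, h3, smul_mul_assoc, mul_assoc (x₁ ^ a), h4,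
    mul_smul_comm, smul_mul_assoc, smul_mul_assoc, smul_mul_assoc, smul_mul_assoc, smul_smul,
    ← mul_assoc (x₁ ^ a), mul_assoc _ (Z t)]
  refine Submodule.smul_mem _ _ ?_
  have : Submodule.span k {y | ∃ i ≤ c, ∃ s, y = x₂ ^ i * Z s} ≤
      (boxSpan k G x₁ x₂ Z (N + 1)).comap
        ((LinearMap.mulRight k (descProd Z (2 * G + 1) n)).comp
          (LinearMap.mulLeft k (x₁ ^ a * (x₂ * x₁ + x₁ * x₂) ^ b))) := by
    refine Submodule.span_le.mpr ?_
    rintro _ ⟨i, hi, s, rfl⟩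
    simp only [Submodule.comap_coe, Set.mem_preimage, LinearMap.comp_apply,
      LinearMap.mulLeft_apply, LinearMap.mulRight_apply, SetLike.mem_coe]
    by_cases hs : s < 2 * G + 1
    · obtain ⟨d, hd⟩ := h.exists_z_mul_descProd hq hs n
      rw [mul_assoc, mul_assoc (x₂ ^ i), hd, mul_smul_comm, mul_smul_comm, ← mul_assoc]
      refine Submodule.smul_mem _ _ (mem_boxSpan (by omega) (by omega) fun r hr => ?_)
      have := hn r hr
      have := hn s
      simp only [Function.update_apply]
      split_ifs with hrs
      · subst hrs
        omega
      · omega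
    · rw [h.z_eq_zero (by omega)]
      simp
  exact this (h.z_mul_x₂_pow_mem hq c t)

/-- The span of the ordered monomials satisfying the constraints on the exponents contains the span
of all ordered monomials. -/
theorem boxSpan_le (h : IsLstr q G x₁ x₂ Z) {N : ℕ} {M : Submodule k A}
    (hM : ∀ (a b c : ℕ) (n : ℕ → ℕ), a ≤ 1 → b ≤ N → c ≤ N → (∀ t, t % 2 = 0 → n t ≤ N) →
      (∀ t, t % 2 = 1 → t < 2 * G + 1 → n t ≤ 1) →
      x₁ ^ a * (x₂ * x₁ + x₁ * x₂) ^ b * x₂ ^ c * descProd Z (2 * G + 1) n ∈ M) :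
    boxSpan k G x₁ x₂ Z N ≤ M := by
  refine Submodule.span_le.mpr ?_
  rintro _ ⟨a, b, c, n, hb, hc, hn, rfl⟩
  by_cases ha : a ≤ 1
  · by_cases hn' : ∀ t, t % 2 = 1 → t < 2 * G + 1 → n t ≤ 1
    · exact hM a b c n ha hb hc hn hn'
    · push Not at hn'
      obtain ⟨t, ht, htG, hnt⟩ := hn'
      rw [descProd_eq_zero Z htG (h.pow_eq_zero_of_odd ht hnt), mul_zero]
      exact M.zero_mem
  · obtain ⟨a, rfl⟩ := Nat.exists_eq_add_of_le (show 2 ≤ a by omega)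
    rw [pow_add, pow_two, h.sq, zero_mul, zero_mul, zero_mul, zero_mul]
    exact M.zero_mem

end IsLstr

end boxSpan

section Exponents

/-- The linear operator sending the basis vector `n` to `c n` times the basis vector `f n`. -/
noncomputable def weightedShift {k I J : Type*} [Field k] (c : I → k) (f : I → J) :
    (I →₀ k) →ₗ[k] (J →₀ k) :=
  Finsupp.linearCombination k fun n => Finsupp.single (f n) (c n)

@[simp]
theorem weightedShift_single {k I J : Type*} [Field k] (c : I → k) (f : I → J) (n : I) (r : k) :
    weightedShift c f (Finsupp.single n r) = Finsupp.single (f n) (r * c n) := by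
  simp [weightedShift]

variable {k : Type*} [Field k]

theorem weightedShift_comp_eq_smul {I J K L : Type*} {c : I → k} {f : I → J} {d : J → k}
    {g : J → K} {c' : I → k} {f' : I → L} {d' : L → k} {g' : L → K} {r : k}
    (h : ∀ n, c n * d (f n) = r * (c' n * d' (f' n)))
    (h' : ∀ n, c n * d (f n) ≠ 0 → g (f n) = g' (f' n)) :
    weightedShift d g ∘ₗ weightedShift c f =
      r • (weightedShift d' g' ∘ₗ weightedShift c' f') := by
  refine Finsupp.lhom_ext' fun n => LinearMap.ext_ring ?_
  simp only [LinearMap.comp_apply, Finsupp.lsingle_apply, weightedShift_single, one_mul,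
    LinearMap.smul_apply, Finsupp.smul_single, smul_eq_mul, ← h]
  by_cases hn : c n * d (f n) = 0
  · simp [hn]
  · rw [h' n hn]

/-- The commutation factor: `z_t z_s = braidFactor q t s • z_s z_t`. -/
def braidFactor (q : k) (t s : ℕ) : k := (-1) ^ (t * s) * (q ^ t * (q ^ s)⁻¹)

theorem braidFactor_mul_swap {q : k} (hq : q ≠ 0) (t s : ℕ) :
    braidFactor q t s * braidFactor q s t = 1 := by
  have : ((-1 : k) ^ (t * s)) * (-1) ^ (s * t) = 1 := by
    rw [mul_comm s t, ← mul_pow]; simp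
  have h1 := pow_ne_zero t hq
  have h2 := pow_ne_zero s hq
  unfold braidFactor
  field_simp
  rw [mul_comm t s] at this ⊢
  linear_combination this

theorem braidFactor_ne_zero {q : k} (hq : q ≠ 0) (t s : ℕ) : braidFactor q t s ≠ 0 :=
  left_ne_zero_of_mul_eq_one (braidFactor_mul_swap hq t s)

/-- The scalar produced by moving `z_t` to the left past all `z_s`, `s < t`, in a monomial with
exponent vector `n`. -/
def braidCoeff (q : k) (t : ℕ) (n : ℕ →₀ ℕ) : k :=
  ∏ s ∈ Finset.range t, braidFactor q s t ^ n s

theorem braidCoeff_ne_zero {q : k} (hq : q ≠ 0) (t : ℕ) (n : ℕ →₀ ℕ) : braidCoeff q t n ≠ 0 :=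
  Finset.prod_ne_zero_iff.mpr fun _ _ => pow_ne_zero _ (braidFactor_ne_zero hq _ _)

theorem braidCoeff_add_single (q : k) (t s : ℕ) (n : ℕ →₀ ℕ) :
    braidCoeff q t (n + Finsupp.single s 1) =
      braidCoeff q t n * if s < t then braidFactor q s t else 1 := by
  simp only [braidCoeff, Finsupp.add_apply, pow_add, Finset.prod_mul_distrib]
  congr 1
  simp only [Finsupp.single_apply]
  split_ifs with h
  · rw [Finset.prod_eq_single_of_mem s (by simpa using h)]
    · simp
    · intro b _ hb
      simp [hb.symm]
  · refine Finset.prod_eq_one fun b hb => ?_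
    rw [if_neg, pow_zero]
    rintro rfl
    exact h (by simpa using hb)

/-- Whether the exponent `m` of `z_t` may be raised. -/
def raiseCoeff (k : Type*) [Field k] (t m : ℕ) : k := if t % 2 = 1 ∧ m % 2 = 1 then 0 else 1

/-- The coefficient of the derivation with respect to `z_t`. -/
def lowerCoeff (k : Type*) [Field k] (t m : ℕ) : k :=
  if t % 2 = 1 then (if m % 2 = 1 then 1 else 0) else m

/-- Right multiplication by `z_t` in the algebra of skew polynomials in the `z_t`. -/
noncomputable def raiseOp (q : k) (t : ℕ) : Module.End k ((ℕ →₀ ℕ) →₀ k) :=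
  weightedShift (fun n => raiseCoeff k t (n t) * braidCoeff q t n)
    (fun n => n + Finsupp.single t 1)

/-- The skew derivation with respect to `z_t`. -/
noncomputable def lowerOp (q : k) (t : ℕ) : Module.End k ((ℕ →₀ ℕ) →₀ k) :=
  weightedShift (fun n => lowerCoeff k t (n t) * (braidCoeff q t n)⁻¹)
    (fun n => n - Finsupp.single t 1)

/-- The eigenvalue of the grading automorphism. -/
noncomputable def gradeCoeff (q : k) (n : ℕ →₀ ℕ) : k := n.prod fun t m => ((-1) ^ t * q⁻¹) ^ m

/-- The grading automorphism `z_t ↦ (-1)^t q⁻¹ z_t`. -/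
noncomputable def gradeOp (q : k) : Module.End k ((ℕ →₀ ℕ) →₀ k) :=
  weightedShift (fun n => gradeCoeff q n) id

theorem gradeCoeff_add_single (q : k) (n : ℕ →₀ ℕ) (t : ℕ) :
    gradeCoeff q (n + Finsupp.single t 1) = gradeCoeff q n * ((-1) ^ t * q⁻¹) := by
  unfold gradeCoeff
  rw [Finsupp.prod_add_index' (by simp) (by simp [pow_add]), Finsupp.prod_single_index (by simp),
    pow_one]

theorem raiseOp_comp_of_ne {q : k} (hq : q ≠ 0) {t s : ℕ} (hts : t ≠ s) :
    raiseOp q t ∘ₗ raiseOp q s = braidFactor q s t • (raiseOp q s ∘ₗ raiseOp q t) := by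
  refine weightedShift_comp_eq_smul (fun n => ?_) fun n _ => by abel
  have h := braidFactor_mul_swap hq s t
  simp only [braidCoeff_add_single, Finsupp.add_apply, Finsupp.single_apply, if_neg hts,
    if_neg hts.symm, add_zero]
  rcases lt_or_gt_of_ne hts with hlt | hlt
  · rw [if_pos hlt, if_neg (by omega)]
    linear_combination (-raiseCoeff k s (n s) * raiseCoeff k t (n t) * braidCoeff q s n *
      braidCoeff q t n) * h
  · rw [if_pos hlt, if_neg (by omega)]
    ring

theorem raiseOp_comp_self_of_odd (q : k) {t : ℕ} (ht : t % 2 = 1) :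
    raiseOp q t ∘ₗ raiseOp q t = 0 := by
  rw [← zero_smul k (raiseOp q t ∘ₗ raiseOp q t)]
  have hn : ∀ n : ℕ →₀ ℕ,
      raiseCoeff k t (n t) * raiseCoeff k t ((n + Finsupp.single t 1 : ℕ →₀ ℕ) t) = 0 := by
    intro n
    simp only [raiseCoeff, ht, Finsupp.add_apply, Finsupp.single_eq_same]
    rcases Nat.mod_two_eq_zero_or_one (n t) with h | h
    · rw [if_pos (c := True ∧ (n t + 1) % 2 = 1) ⟨trivial, by omega⟩, mul_zero]
    · rw [if_pos (c := True ∧ n t % 2 = 1) ⟨trivial, h⟩, zero_mul]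
  refine weightedShift_comp_eq_smul (fun n => ?_) fun n _ => rfl
  linear_combination (braidCoeff q t n * braidCoeff q t (n + Finsupp.single t 1)) * hn n

theorem raiseOp_comp {q : k} (hq : q ≠ 0) (t s : ℕ) :
    raiseOp q t ∘ₗ raiseOp q s = braidFactor q s t • (raiseOp q s ∘ₗ raiseOp q t) := by
  rcases eq_or_ne t s with rfl | h
  · rcases Nat.mod_two_eq_zero_or_one t with ht | ht
    · have : braidFactor q t t = 1 := by
        rw [braidFactor, mul_inv_cancel₀ (pow_ne_zero _ hq), mul_one, Even.neg_one_pow]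
        exact (Nat.even_iff.mpr ht).mul_left t
      rw [this, one_smul]
    · rw [raiseOp_comp_self_of_odd q ht, smul_zero]
  · exact raiseOp_comp_of_ne hq h

theorem lowerCoeff_zero (t : ℕ) : lowerCoeff k t 0 = 0 := by simp [lowerCoeff]

theorem exists_eq_add_single {n : ℕ →₀ ℕ} {t : ℕ} (h : n t ≠ 0) :
    ∃ m : ℕ →₀ ℕ, n = m + Finsupp.single t 1 :=
  ⟨n - Finsupp.single t 1, (tsub_add_cancel_of_le (by
    rw [Finsupp.single_le_iff]; omega)).symm⟩

theorem lowerOp_comp_raiseOp_of_ne {q : k} (hq : q ≠ 0) {t s : ℕ} (hts : t ≠ s) :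
    lowerOp q t ∘ₗ raiseOp q s = braidFactor q t s • (raiseOp q s ∘ₗ lowerOp q t) := by
  have hs : ∀ n : ℕ →₀ ℕ, (n + Finsupp.single s 1 : ℕ →₀ ℕ) t = n t := fun n => by
    simp [hts.symm]
  refine weightedShift_comp_eq_smul (fun n => ?_) fun n hn => ?_
  · rw [hs]
    rcases eq_or_ne (n t) 0 with h0 | h0
    · simp [h0, lowerCoeff_zero]
    · obtain ⟨m, rfl⟩ := exists_eq_add_single h0
      have h1 := braidFactor_ne_zero hq s t
      have h2 := braidFactor_ne_zero hq t s
      have h3 := braidCoeff_ne_zero hq t m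
      have h := braidFactor_mul_swap hq s t
      simp only [add_tsub_cancel_right, braidCoeff_add_single, Finsupp.add_apply,
        Finsupp.single_apply, if_neg hts, lt_irrefl, if_false, mul_one, add_zero, if_true]
      rcases lt_or_gt_of_ne hts with hlt | hlt
      · rw [if_pos hlt, if_neg (by omega)]
        field_simp
      · rw [if_pos hlt, if_neg (by omega)]
        field_simp
        linear_combination (-(raiseCoeff k s (m s) * braidCoeff q s m *
          lowerCoeff k t (m t + 1))) * h
  · rcases eq_or_ne (n t) 0 with h0 | h0
    · rw [hs, h0, lowerCoeff_zero] at hn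
      simp at hn
    · obtain ⟨m, rfl⟩ := exists_eq_add_single h0
      rw [add_right_comm, add_tsub_cancel_right, add_tsub_cancel_right]

theorem lowerOp_comp_raiseOp_self {q : k} (hq : q ≠ 0) (t : ℕ) :
    lowerOp q t ∘ₗ raiseOp q t = (-1 : k) ^ t • (raiseOp q t ∘ₗ lowerOp q t) + 1 := by
  refine Finsupp.lhom_ext' fun n => LinearMap.ext_ring ?_
  have hb := braidCoeff_ne_zero hq t n
  simp only [lowerOp, raiseOp, LinearMap.comp_apply, Finsupp.lsingle_apply, weightedShift_single,
    one_mul, LinearMap.add_apply, LinearMap.smul_apply, Finsupp.smul_single, smul_eq_mul,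
    add_tsub_cancel_right, Module.End.one_apply, braidCoeff_add_single, lt_irrefl, if_false,
    mul_one, Finsupp.add_apply, Finsupp.single_eq_same]
  rcases eq_or_ne (n t) 0 with h0 | h0
  · rw [h0, lowerCoeff_zero]
    simp only [zero_mul, mul_zero, Finsupp.single_zero, zero_add]
    congr 1
    have : raiseCoeff k t 0 * lowerCoeff k t 1 = 1 := by simp [raiseCoeff, lowerCoeff]
    field_simp
    exact this
  · obtain ⟨m, rfl⟩ := exists_eq_add_single h0
    rw [add_tsub_cancel_right, ← Finsupp.single_add]
    congr 1
    have hb' := braidCoeff_ne_zero hq t m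
    simp only [Finsupp.add_apply, Finsupp.single_eq_same, braidCoeff_add_single, lt_irrefl,
      if_false, mul_one]
    have : raiseCoeff k t (m t + 1) * lowerCoeff k t (m t + 1 + 1) =
        (-1) ^ t * (lowerCoeff k t (m t + 1) * raiseCoeff k t (m t)) + 1 := by
      rcases Nat.mod_two_eq_zero_or_one t with ht | ht
      · simp [raiseCoeff, lowerCoeff, ht, (Nat.even_iff.mpr ht).neg_one_pow]
      · rcases Nat.mod_two_eq_zero_or_one (m t) with hm | hm <;>
        simp [raiseCoeff, lowerCoeff, ht, hm, (Nat.odd_iff.mpr ht).neg_one_pow, Nat.add_mod]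
    field_simp
    linear_combination this

theorem gradeOp_comp_raiseOp (q : k) (t : ℕ) :
    gradeOp q ∘ₗ raiseOp q t = ((-1 : k) ^ t * q⁻¹) • (raiseOp q t ∘ₗ gradeOp q) := by
  refine weightedShift_comp_eq_smul (fun n => ?_) fun n _ => rfl
  rw [gradeCoeff_add_single, id]
  ring

theorem lowerOp_comp_gradeOp (q : k) (t : ℕ) :
    lowerOp q t ∘ₗ gradeOp q = ((-1 : k) ^ t * q⁻¹) • (gradeOp q ∘ₗ lowerOp q t) := by
  refine weightedShift_comp_eq_smul (fun n => ?_) fun n _ => rfl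
  rcases eq_or_ne (n t) 0 with h0 | h0
  · simp [h0, lowerCoeff_zero]
  · obtain ⟨m, rfl⟩ := exists_eq_add_single h0
    rw [add_tsub_cancel_right, gradeCoeff_add_single, id]
    ring

end Exponents

section Jordan

variable (k : Type*) [Field k]

/-- Left multiplication by `x₁` in the super Jordan plane. -/
noncomputable def jordanX₁ : Module.End k ((Fin 2 × ℕ × ℕ) →₀ k) :=
  weightedShift (fun p => if p.1 = 0 then 1 else 0) (fun p => (1, p.2))

/-- Left multiplication by `x₂` in the super Jordan plane. -/
noncomputable def jordanX₂ : Module.End k ((Fin 2 × ℕ × ℕ) →₀ k) :=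
  Finsupp.linearCombination k fun p =>
    if p.1 = 0 then
      Finsupp.single (0, p.2.1, p.2.2 + 1) 1 + Finsupp.single (1, p.2.1, p.2.2) (p.2.1 : k)
    else Finsupp.single (0, p.2.1 + 1, p.2.2) 1 - Finsupp.single (1, p.2.1, p.2.2 + 1) 1

theorem jordanX₁_zero (b c : ℕ) (r : k) :
    jordanX₁ k (Finsupp.single (0, b, c) r) = Finsupp.single (1, b, c) r := by
  simp [jordanX₁]

theorem jordanX₁_one (b c : ℕ) (r : k) :
    jordanX₁ k (Finsupp.single (1, b, c) r) = 0 := by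
  simp [jordanX₁]

theorem jordanX₂_zero (b c : ℕ) (r : k) : jordanX₂ k (Finsupp.single (0, b, c) r) =
    Finsupp.single (0, b, c + 1) r + Finsupp.single (1, b, c) (r * b) := by
  simp [jordanX₂]

theorem jordanX₂_one (b c : ℕ) (r : k) : jordanX₂ k (Finsupp.single (1, b, c) r) =
    Finsupp.single (0, b + 1, c) r - Finsupp.single (1, b, c + 1) r := by
  simp [jordanX₂, smul_sub]

theorem jordan_x₂₁ (a : Fin 2) (b c : ℕ) (r : k) :
    (jordanX₂ k * jordanX₁ k + jordanX₁ k * jordanX₂ k) (Finsupp.single (a, b, c) r) =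
      Finsupp.single (a, b + 1, c) r := by
  match a with
  | 0 =>
    simp only [LinearMap.add_apply, Module.End.mul_apply, jordanX₁_zero, jordanX₁_one,
      jordanX₂_zero, jordanX₂_one, map_add, add_zero, sub_add_cancel]
  | 1 => simp [jordanX₁_zero, jordanX₁_one, jordanX₂_one]

theorem jordan_sq : jordanX₁ k * jordanX₁ k = 0 := by
  refine Finsupp.lhom_ext fun ⟨a, b, c⟩ r => ?_
  match a with
  | 0 => simp [jordanX₁_zero, jordanX₁_one]
  | 1 => simp [jordanX₁_one]

theorem jordan_rel : jordanX₂ k * (jordanX₂ k * jordanX₁ k + jordanX₁ k * jordanX₂ k) =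
    (jordanX₂ k * jordanX₁ k + jordanX₁ k * jordanX₂ k) * jordanX₂ k +
      jordanX₁ k * (jordanX₂ k * jordanX₁ k + jordanX₁ k * jordanX₂ k) := by
  have h := jordan_x₂₁ k
  generalize jordanX₂ k * jordanX₁ k + jordanX₁ k * jordanX₂ k = w at *
  refine Finsupp.lhom_ext fun ⟨a, b, c⟩ r => ?_
  match a with
  | 0 =>
    simp only [Module.End.mul_apply, LinearMap.add_apply, h, jordanX₂_zero, jordanX₁_zero, map_add]
    rw [add_assoc, ← Finsupp.single_add]
    push_cast
    rw [mul_add, mul_one]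
  | 1 =>
    simp [Module.End.mul_apply, LinearMap.add_apply, h, jordanX₂_one, jordanX₁_one]

theorem jordan_monomial_apply (a : Fin 2) (b c : ℕ) :
    (jordanX₁ k ^ (a : ℕ) * (jordanX₂ k * jordanX₁ k + jordanX₁ k * jordanX₂ k) ^ b *
      jordanX₂ k ^ c) (Finsupp.single (0, 0, 0) 1) = Finsupp.single (a, b, c) 1 := by
  have h := jordan_x₂₁ k
  generalize jordanX₂ k * jordanX₁ k + jordanX₁ k * jordanX₂ k = w at *
  have h1 : (jordanX₂ k ^ c) (Finsupp.single (0, 0, 0) 1) = Finsupp.single (0, 0, c) 1 := by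
    induction c with
    | zero => simp
    | succ c ih => rw [pow_succ', Module.End.mul_apply, ih, jordanX₂_zero]; simp
  have h2 : (w ^ b) (Finsupp.single (0, 0, c) 1) = Finsupp.single (0, b, c) 1 := by
    induction b with
    | zero => simp
    | succ b ih => rw [pow_succ', Module.End.mul_apply, ih, h]
  rw [Module.End.mul_apply, Module.End.mul_apply, h1, h2]
  match a with
  | 0 => simp
  | 1 => simp [jordanX₁_zero]

end Jordan

section Tensor

open scoped TensorProduct

variable {k : Type*} [Field k]

theorem isLstr_tmul {E₁ E₂ : Type*} [Ring E₁] [Algebra k E₁] [Ring E₂] [Algebra k E₂] {q : k}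
    {G : ℕ} {ξ₁ ξ₂ : E₁} {S D : E₂} {r : ℕ → E₂} (hsq : ξ₁ * ξ₁ = 0)
    (hj : ξ₂ * (ξ₂ * ξ₁ + ξ₁ * ξ₂) = (ξ₂ * ξ₁ + ξ₁ * ξ₂) * ξ₂ + ξ₁ * (ξ₂ * ξ₁ + ξ₁ * ξ₂))
    (hS : ∀ t, S * r t = ((-1 : k) ^ t * q) • (r t * S))
    (hD : ∀ t, D * r t = r (t + 1) + ((-1 : k) ^ t * q) • (r t * D))
    (hSD : S * D = -(D * S)) (htop : r (2 * G + 1) = 0)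
    (hr : ∀ j < G, r (2 * j + 1) * r (2 * j + 1) = 0)
    (hr' : ∀ j < G, r (2 * j) * r (2 * j + 1) = q⁻¹ • (r (2 * j + 1) * r (2 * j))) :
    IsLstr q G (ξ₁ ⊗ₜ[k] S) (ξ₂ ⊗ₜ[k] S + 1 ⊗ₜ[k] D) (fun t => (1 : E₁) ⊗ₜ[k] r t) ∧
    (ξ₂ ⊗ₜ[k] S + 1 ⊗ₜ[k] D) * (ξ₁ ⊗ₜ[k] S) + (ξ₁ ⊗ₜ[k] S) * (ξ₂ ⊗ₜ[k] S + 1 ⊗ₜ[k] D) =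
      (ξ₂ * ξ₁ + ξ₁ * ξ₂) ⊗ₜ[k] (S * S) := by
  have h21 : (ξ₂ ⊗ₜ[k] S + 1 ⊗ₜ[k] D) * (ξ₁ ⊗ₜ[k] S) + (ξ₁ ⊗ₜ[k] S) * (ξ₂ ⊗ₜ[k] S + 1 ⊗ₜ[k] D) =
      (ξ₂ * ξ₁ + ξ₁ * ξ₂) ⊗ₜ[k] (S * S) := by
    simp only [add_mul, mul_add, Algebra.TensorProduct.tmul_mul_tmul, one_mul, mul_one, hSD,
      TensorProduct.tmul_neg, TensorProduct.add_tmul]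
    abel
  refine ⟨⟨?_, ?_, ?_, ?_, ?_, ?_, ?_, ?_⟩, h21⟩
  · rw [Algebra.TensorProduct.tmul_mul_tmul, hsq, TensorProduct.zero_tmul]
  · rw [h21]
    have hDS : D * (S * S) = S * S * D := by
      have : D * S = -(S * D) := by rw [hSD, neg_neg]
      rw [← mul_assoc, this, neg_mul, mul_assoc, this, mul_neg, neg_neg, mul_assoc]
    rw [add_mul, mul_add]
    simp only [Algebra.TensorProduct.tmul_mul_tmul, one_mul, mul_one]
    rw [hDS, hj, TensorProduct.add_tmul, mul_assoc S S S]
    abel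
  · have := hS 0
    simp only [pow_zero, one_mul] at this
    rw [Algebra.TensorProduct.tmul_mul_tmul, Algebra.TensorProduct.tmul_mul_tmul, one_mul, mul_one,
      this, TensorProduct.tmul_smul]
  · have := hS 0
    simp only [pow_zero, one_mul] at this
    rw [h21, Algebra.TensorProduct.tmul_mul_tmul, Algebra.TensorProduct.tmul_mul_tmul, one_mul,
      mul_one, mul_assoc, this, mul_smul_comm, ← mul_assoc, this, smul_mul_assoc, smul_smul,
      TensorProduct.tmul_smul, mul_assoc, pow_two]
  · intro t
    simp only [add_mul, mul_add, Algebra.TensorProduct.tmul_mul_tmul, one_mul, mul_one, hS, hD,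
      TensorProduct.tmul_smul, TensorProduct.tmul_add, smul_add]
    abel
  · simp only [htop, TensorProduct.tmul_zero]
  · intro j hj
    simp only [Algebra.TensorProduct.tmul_mul_tmul, one_mul, hr j hj, TensorProduct.tmul_zero]
  · intro j hj
    simp only [Algebra.TensorProduct.tmul_mul_tmul, one_mul, hr' j hj, TensorProduct.tmul_smul]

/-- Evaluation of the second factor at a vector. -/
noncomputable def evalSnd {E M : Type*} [Ring E] [Algebra k E] [AddCommGroup M] [Module k M]
    (v : M) : E ⊗[k] (Module.End k M)ᵐᵒᵖ →ₗ[k] E ⊗[k] M :=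
  TensorProduct.map LinearMap.id
    ((LinearMap.applyₗ v).comp (MulOpposite.opLinearEquiv k).symm.toLinearMap)

theorem evalSnd_mul_tmul {E M : Type*} [Ring E] [Algebra k E] [AddCommGroup M] [Module k M]
    {v : M} {e : E ⊗[k] (Module.End k M)ᵐᵒᵖ} {u : E} {m : M}
    (he : evalSnd v e = u ⊗ₜ[k] m) (f : E) (g : Module.End k M) :
    evalSnd v (e * (f ⊗ₜ[k] MulOpposite.op g)) = (u * f) ⊗ₜ[k] g m := by
  have : evalSnd v (e * (f ⊗ₜ[k] MulOpposite.op g)) =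
      TensorProduct.map (LinearMap.mulRight k f) g (evalSnd v e) := by
    clear he
    induction e with
    | zero => simp
    | add x y hx hy => rw [add_mul, map_add, map_add, map_add, hx, hy]
    | tmul a b =>
      simp [evalSnd, Algebra.TensorProduct.tmul_mul_tmul]
  rw [this, he, TensorProduct.map_tmul, LinearMap.mulRight_apply]

end Tensor

section Representation

variable {k : Type*} [Field k]

/-- Right multiplication by `z_t`, where `z_t = 0` for `t > 2G`. -/
noncomputable def ghostOp (q : k) (G t : ℕ) : Module.End k ((ℕ →₀ ℕ) →₀ k) :=
  if t ≤ 2 * G then raiseOp q t else 0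

/-- The skew derivation `z_t ↦ z_{t+1}`, up to normalization. -/
noncomputable def ghostDeriv (q : k) (G : ℕ) : Module.End k ((ℕ →₀ ℕ) →₀ k) :=
  ∑ t ∈ Finset.range (2 * G), (-((-1) ^ t * q⁻¹)) • (raiseOp q (t + 1) * lowerOp q t)

theorem neg_one_pow_mul_self (t : ℕ) : (-1 : k) ^ t * (-1) ^ t = 1 := by
  rw [← mul_pow]; simp

theorem ghostOp_mul_gradeOp {q : k} (hq : q ≠ 0) (G t : ℕ) :
    ghostOp q G t * gradeOp q = ((-1 : k) ^ t * q) • (gradeOp q * ghostOp q G t) := by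
  unfold ghostOp
  split_ifs
  · rw [Module.End.mul_eq_comp (gradeOp q), gradeOp_comp_raiseOp, smul_smul, mul_mul_mul_comm,
      neg_one_pow_mul_self, mul_inv_cancel₀ hq, one_mul, one_smul, Module.End.mul_eq_comp]
  · simp

theorem sum_smul_mul_eq {E : Type*} [Ring E] [Algebra k E] (I : Finset ℕ) {c : ℕ → k} {s : ℕ}
    {a b : ℕ → E} {R : E} {x : k} (hc : c s = -x)
    (h : ∀ t, a t * R = x • (R * a t) + if s = t then b t else 0) :
    (∑ t ∈ I, c t • a t) * R =
      x • (R * ∑ t ∈ I, c t • a t - ∑ t ∈ I, if s = t then b t else 0) := by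
  rw [Finset.sum_mul, Finset.mul_sum, ← Finset.sum_sub_distrib, Finset.smul_sum]
  refine Finset.sum_congr rfl fun t _ => ?_
  rw [smul_mul_assoc, h, smul_add, mul_smul_comm, smul_sub, smul_smul, smul_smul, mul_comm x,
    sub_eq_add_neg]
  congr 1
  split_ifs with hst
  · rw [← hst, hc, neg_smul]
  · simp

theorem sum_smul_mul_anticomm {E : Type*} [Ring E] [Algebra k E] (s : Finset ℕ) {d c : ℕ → k}
    {a b : ℕ → E} {g : E} (hb : ∀ t, b t * g = c t • (g * b t))
    (ha : ∀ t, g * a t = (-c t) • (a t * g)) :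
    (∑ t ∈ s, d t • (a t * b t)) * g = -(g * ∑ t ∈ s, d t • (a t * b t)) := by
  rw [Finset.sum_mul, Finset.mul_sum, ← Finset.sum_neg_distrib]
  refine Finset.sum_congr rfl fun t _ => ?_
  rw [smul_mul_assoc, mul_assoc, hb, mul_smul_comm, mul_smul_comm, ← mul_assoc g, ha,
    smul_mul_assoc, neg_smul, smul_neg, neg_neg, mul_assoc]

theorem ghostDeriv_mul_raiseOp {q : k} (hq : q ≠ 0) (G s : ℕ) :
    ghostDeriv q G * raiseOp q s =
      ((-1) ^ s * q⁻¹) • (raiseOp q s * ghostDeriv q G - ghostOp q G (s + 1)) := by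
  have key : ∀ t, raiseOp q (t + 1) * lowerOp q t * raiseOp q s =
      ((-1) ^ s * q⁻¹) • (raiseOp q s * (raiseOp q (t + 1) * lowerOp q t)) +
        if s = t then raiseOp q (t + 1) else 0 := by
    intro t
    have hb : braidFactor q s (t + 1) * braidFactor q t s = (-1) ^ s * q⁻¹ := by
      have h1 := pow_ne_zero t hq
      have h2 := pow_ne_zero s hq
      have := neg_one_pow_mul_self (k := k) (s * t)
      simp only [braidFactor, mul_add, mul_one, pow_add, mul_comm t s]
      field_simp
      linear_combination this
    have hR : raiseOp q (t + 1) * raiseOp q s =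
      braidFactor q s (t + 1) • (raiseOp q s * raiseOp q (t + 1)) := raiseOp_comp hq _ _
    split_ifs with h
    · subst h
      have hL : lowerOp q s * raiseOp q s = (-1 : k) ^ s • (raiseOp q s * lowerOp q s) + 1 :=
        lowerOp_comp_raiseOp_self hq s
      rw [mul_assoc, hL, mul_add, mul_one, mul_smul_comm, ← mul_assoc, hR, smul_mul_assoc,
        smul_smul, mul_assoc]
      congr 2
      have h2 := pow_ne_zero s hq
      rw [← hb]
      have : braidFactor q s s = (-1) ^ s := by
        rw [braidFactor, mul_inv_cancel₀ h2, mul_one]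
        rcases Nat.even_or_odd s with h | h
        · rw [(h.mul_left s).neg_one_pow, h.neg_one_pow]
        · rw [(h.mul h).neg_one_pow, h.neg_one_pow]
      rw [this, mul_comm]
    · have hL : lowerOp q t * raiseOp q s = braidFactor q t s • (raiseOp q s * lowerOp q t) :=
        lowerOp_comp_raiseOp_of_ne hq (Ne.symm h)
      rw [mul_assoc, hL, mul_smul_comm, ← mul_assoc, hR, smul_mul_assoc, smul_smul, mul_assoc,
        mul_comm, hb, add_zero]
  have hg : ghostOp q G (s + 1) = ∑ t ∈ Finset.range (2 * G),
      if s = t then raiseOp q (t + 1) else 0 := by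
    rw [Finset.sum_ite_eq]
    simp only [ghostOp, Finset.mem_range, Nat.succ_le_iff]
  rw [hg]
  exact sum_smul_mul_eq (E := Module.End k ((ℕ →₀ ℕ) →₀ k)) _ rfl key

theorem ghostOp_mul_ghostDeriv {q : k} (hq : q ≠ 0) (G t : ℕ) :
    ghostOp q G t * ghostDeriv q G =
      ghostOp q G (t + 1) + ((-1 : k) ^ t * q) • (ghostDeriv q G * ghostOp q G t) := by
  by_cases ht : t ≤ 2 * G
  · have : ghostOp q G t = raiseOp q t := if_pos ht
    rw [this, ghostDeriv_mul_raiseOp hq, smul_smul, mul_mul_mul_comm,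
      neg_one_pow_mul_self, mul_inv_cancel₀ hq, one_mul, one_smul]
    abel
  · have h1 : ghostOp q G t = 0 := if_neg ht
    have h2 : ghostOp q G (t + 1) = 0 := if_neg (by omega)
    simp [h1, h2]

theorem ghostDeriv_mul_gradeOp (q : k) (G : ℕ) :
    ghostDeriv q G * gradeOp q = -(gradeOp q * ghostDeriv q G) := by
  refine sum_smul_mul_anticomm (E := Module.End k ((ℕ →₀ ℕ) →₀ k)) _
    (c := fun t => (-1) ^ t * q⁻¹) (lowerOp_comp_gradeOp q) fun t => ?_
  rw [← neg_mul, ← mul_neg_one, ← pow_succ]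
  exact gradeOp_comp_raiseOp q (t + 1)

theorem raiseOp_pow_single (q : k) {t j : ℕ} (n : ℕ →₀ ℕ) (hn : ∀ s ≤ t, n s = 0)
    (hj : t % 2 = 1 → j ≤ 1) : (raiseOp q t ^ j) (Finsupp.single n 1) =
      Finsupp.single (n + Finsupp.single t j) 1 := by
  induction j with
  | zero => simp
  | succ j ih =>
    have h1 : braidCoeff q t (n + Finsupp.single t j) = 1 := by
      refine Finset.prod_eq_one fun s hs => ?_
      have := Finset.mem_range.mp hs
      have hst : t ≠ s := by omega
      simp [hn s this.le, hst]
    have h2 : raiseCoeff k t ((n + Finsupp.single t j : ℕ →₀ ℕ) t) = 1 := by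
      refine if_neg fun h => ?_
      have := hj h.1
      have := h.2
      simp [hn t le_rfl] at this
      omega
    rw [pow_succ', Module.End.mul_apply, ih fun h => (Nat.le_succ j).trans (hj h), raiseOp,
      weightedShift_single, h1, h2, add_assoc, ← Finsupp.single_add]
    simp

end Representation

section Independence

open scoped TensorProduct

variable {k : Type*} [Field k]

theorem isLstr_ringQuot (q : k) (G : ℕ) :
    IsLstr q G (RingQuot.mkAlgHom k (lstrRel k q G) (X k 0))
      (RingQuot.mkAlgHom k (lstrRel k q G) (X k 1))
      (fun t => RingQuot.mkAlgHom k (lstrRel k q G) (z k q t)) := by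
  have key : ∀ {a}, lstrRel k q G a 0 → RingQuot.mkAlgHom k (lstrRel k q G) a = 0 := fun h => by
    rw [RingQuot.mkAlgHom_rel k h, map_zero]
  have h21 : RingQuot.mkAlgHom k (lstrRel k q G) (X k 1) *
      RingQuot.mkAlgHom k (lstrRel k q G) (X k 0) + RingQuot.mkAlgHom k (lstrRel k q G) (X k 0) *
      RingQuot.mkAlgHom k (lstrRel k q G) (X k 1) =
      RingQuot.mkAlgHom k (lstrRel k q G) (x21 k) := by simp [x21]
  refine ⟨?_, ?_, ?_, ?_, ?_, ?_, ?_, ?_⟩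
  · rw [← map_mul]
    exact key ⟨rfl, by tauto⟩
  · have := key (a := X k 1 * x21 k - x21 k * X k 1 - X k 0 * x21 k)
      ⟨rfl, by tauto⟩
    rw [h21, ← map_mul, ← map_mul, ← map_mul, ← map_add, ← sub_eq_zero, ← map_sub, ← sub_sub]
    exact this
  · rw [← map_mul, ← map_mul, ← map_smul, ← sub_eq_zero, ← map_sub]
    exact key ⟨rfl, by unfold z; tauto⟩
  · rw [h21, ← map_mul, ← map_mul, ← map_smul, ← sub_eq_zero, ← map_sub]
    exact key ⟨rfl, by unfold z; tauto⟩
  · intro t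
    rw [← map_mul, ← map_mul, ← map_smul, ← map_add]
    simp only [z, sub_add_cancel]
  · exact key ⟨rfl, by tauto⟩
  · intro j hj
    rw [← map_mul]
    exact key ⟨rfl, Or.inr (Or.inr (Or.inr (Or.inr (Or.inr (Or.inl ⟨j, hj, rfl⟩)))))⟩
  · intro j hj
    rw [← map_mul, ← map_mul, ← map_smul, ← sub_eq_zero, ← map_sub]
    exact key ⟨rfl, Or.inr (Or.inr (Or.inr (Or.inr (Or.inr (Or.inr ⟨j, hj, rfl⟩)))))⟩

theorem IsLstr.exists_algHom {A : Type*} [Ring A] [Algebra k A] {q : k} {G : ℕ} {x₁ x₂ : A}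
    {Z : ℕ → A} (h : IsLstr q G x₁ x₂ Z) :
    ∃ φ : RingQuot (lstrRel k q G) →ₐ[k] A,
      φ (RingQuot.mkAlgHom k (lstrRel k q G) (X k 0)) = x₁ ∧
      φ (RingQuot.mkAlgHom k (lstrRel k q G) (X k 1)) = x₂ ∧
      ∀ t, φ (RingQuot.mkAlgHom k (lstrRel k q G) (z k q t)) = Z t := by
  obtain ⟨f, hf⟩ : ∃ f : FreeAlgebra k (Fin 3) →ₐ[k] A, f = FreeAlgebra.lift k ![x₁, x₂, Z 0] :=
    ⟨_, rfl⟩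
  have h0 : f (X k 0) = x₁ := by simp [hf, X]
  have h1 : f (X k 1) = x₂ := by simp [hf, X]
  have h2 : f (X k 2) = Z 0 := by simp [hf, X]
  have hz : ∀ t, f (z k q t) = Z t := fun t => by
    induction t with
    | zero => exact h2
    | succ t ih => simp only [z, map_sub, map_mul, map_smul, h1, ih, h.z_succ, add_sub_cancel_right]
  have h21 : f (x21 k) = x₂ * x₁ + x₁ * x₂ := by simp [x21, h0, h1]
  have hrel : ∀ ⦃a b⦄, lstrRel k q G a b → f a = f b := by
    rintro a b ⟨rfl, rfl | rfl | rfl | rfl | rfl | ⟨j, hj, rfl⟩ | ⟨j, hj, rfl⟩⟩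
    · simp [h0, h.sq]
    · simp only [map_sub, map_mul, h0, h1, h21, h.jordan, map_zero]
      abel
    · simp [h0, h2, h.x₁_z₀]
    · simp [h21, h2, h.x₂₁_z₀]
    · simp [hz, h.z_top]
    · simp [hz, h.z_sq j hj]
    · simp [hz, h.z_comm j hj]
  refine ⟨RingQuot.liftAlgHom k ⟨f, hrel⟩, ?_, ?_, fun t => ?_⟩ <;>
    rw [RingQuot.liftAlgHom_mkAlgHom_apply]
  exacts [h0, h1, hz t]

/-- Extension by zero of a finite sequence of exponents. -/
def extendExp {m : ℕ} (n : Fin m → ℕ) (t : ℕ) : ℕ := if h : t < m then n ⟨t, h⟩ else 0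

theorem extendExp_val {m : ℕ} (n : Fin m → ℕ) (t : Fin m) : extendExp n t = n t := by
  simp [extendExp]

theorem bas_eq (q : k) (G : ℕ) (p : Fin 2 × ℕ × ℕ ×
      {n : Fin (2 * G + 1) → ℕ // ∀ t : Fin (2 * G + 1), (t : ℕ) % 2 = 1 → n t ≤ 1}) :
    bas k q G p = RingQuot.mkAlgHom k (lstrRel k q G) (X k 0) ^ (p.1 : ℕ) *
      (RingQuot.mkAlgHom k (lstrRel k q G) (X k 1) * RingQuot.mkAlgHom k (lstrRel k q G) (X k 0) +
        RingQuot.mkAlgHom k (lstrRel k q G) (X k 0) *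
          RingQuot.mkAlgHom k (lstrRel k q G) (X k 1)) ^ p.2.1 *
      RingQuot.mkAlgHom k (lstrRel k q G) (X k 1) ^ p.2.2.1 *
      descProd (fun t => RingQuot.mkAlgHom k (lstrRel k q G) (z k q t)) (2 * G + 1)
        (extendExp p.2.2.2.1) := by
  have h := map_descProd (RingQuot.mkAlgHom k (lstrRel k q G)).toRingHom.toMonoidHom (z k q)
    (2 * G + 1) (extendExp p.2.2.2.1)
  rw [← prod_reverse_ofFn_pow] at h
  simp only [extendExp_val] at h
  rw [bas, map_mul, map_mul, map_mul, map_pow, map_pow, map_pow, x21, map_add, map_mul, map_mul]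
  congr 1

theorem evalSnd_descProd {E : Type*} [Ring E] [Algebra k E] {q : k} {G m : ℕ}
    (hm : m ≤ 2 * G + 1) (v : (ℕ →₀ ℕ) →₀ k) (n : ℕ → ℕ) (hn : ∀ t < m, t % 2 = 1 → n t ≤ 1)
    {u : E} : ∀ (n' : ℕ →₀ ℕ) (_ : ∀ t < m, n' t = 0) (e : E ⊗[k] (Module.End k _)ᵐᵒᵖ)
      (_ : evalSnd v e = u ⊗ₜ[k] Finsupp.single n' 1),
    evalSnd v (e * descProd (fun t => (1 : E) ⊗ₜ[k] MulOpposite.op (ghostOp q G t)) m n) =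
      u ⊗ₜ[k] Finsupp.single (n' + ∑ t ∈ Finset.range m, Finsupp.single t (n t)) 1 := by
  induction m with
  | zero => simp [descProd]
  | succ m ih =>
    intro n' hn' e he
    rw [descProd, ← mul_assoc, Finset.sum_range_succ, add_comm (Finset.sum _ _), ← add_assoc]
    refine ih (by omega) (fun t ht => hn t (by omega)) _ (fun t ht => ?_) _ ?_
    · simp [hn' t (by omega), ht.ne']
    · rw [Algebra.TensorProduct.tmul_pow, ← MulOpposite.op_pow, evalSnd_mul_tmul he, one_pow,
        mul_one, ghostOp, if_pos (by omega),
        raiseOp_pow_single q n' (fun s hs => hn' s (by omega)) (hn m (by omega))]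

theorem linearIndependent_bas {q : k} (hq : q ≠ 0) (G : ℕ) : LinearIndependent k (bas k q G) := by
  obtain ⟨h, h21⟩ := isLstr_tmul (q := q) (G := G)
    (E₁ := Module.End k ((Fin 2 × ℕ × ℕ) →₀ k)) (E₂ := (Module.End k ((ℕ →₀ ℕ) →₀ k))ᵐᵒᵖ)
    (ξ₁ := jordanX₁ k) (ξ₂ := jordanX₂ k) (S := MulOpposite.op (gradeOp q))
    (D := MulOpposite.op (ghostDeriv q G)) (r := fun t => MulOpposite.op (ghostOp q G t))
    (jordan_sq k) (jordan_rel k)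
    (fun t => by
      rw [← MulOpposite.op_mul, ← MulOpposite.op_mul, ← MulOpposite.op_smul,
        ghostOp_mul_gradeOp hq])
    (fun t => by
      rw [← MulOpposite.op_mul, ← MulOpposite.op_mul, ← MulOpposite.op_smul, ← MulOpposite.op_add,
        ghostOp_mul_ghostDeriv hq])
    (by rw [← MulOpposite.op_mul, ← MulOpposite.op_mul, ← MulOpposite.op_neg,
      ghostDeriv_mul_gradeOp])
    (by rw [ghostOp, if_neg (by omega), MulOpposite.op_zero])
    (fun j hj => by
      rw [← MulOpposite.op_mul, ghostOp, if_pos (by omega), Module.End.mul_eq_comp,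
        raiseOp_comp_self_of_odd q (by omega), MulOpposite.op_zero])
    (fun j hj => by
      rw [← MulOpposite.op_mul, ← MulOpposite.op_mul, ← MulOpposite.op_smul, ghostOp, ghostOp,
        if_pos (by omega), if_pos (by omega), Module.End.mul_eq_comp, raiseOp_comp hq,
        Module.End.mul_eq_comp]
      congr 2
      have : (-1 : k) ^ (2 * j * (2 * j + 1)) = 1 := by
        rw [mul_assoc, pow_mul]; simp
      have h1 := pow_ne_zero (2 * j) hq
      rw [braidFactor, this, pow_succ]
      field_simp)
  obtain ⟨φ, h0, h1, hz⟩ := h.exists_algHom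
  have hgrade : gradeOp q (Finsupp.single (0 : ℕ →₀ ℕ) (1 : k)) = Finsupp.single 0 1 := by
    simp [gradeOp, gradeCoeff]
  have hderiv : ghostDeriv q G (Finsupp.single (0 : ℕ →₀ ℕ) (1 : k)) = 0 := by
    simp [ghostDeriv, lowerOp, lowerCoeff_zero]
  obtain ⟨f, hf⟩ : ∃ f : RingQuot (lstrRel k q G) →ₗ[k] (((Fin 2 × ℕ × ℕ) × (ℕ →₀ ℕ)) →₀ k),
      f = (finsuppTensorFinsupp' k (Fin 2 × ℕ × ℕ) (ℕ →₀ ℕ)).toLinearMap ∘ₗ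
        TensorProduct.map (LinearMap.applyₗ (Finsupp.single (0, 0, 0) 1)) LinearMap.id ∘ₗ
        evalSnd (Finsupp.single 0 1) ∘ₗ φ.toLinearMap := ⟨_, rfl⟩
  have key : ∀ p, f (bas k q G p) = Finsupp.single ((p.1, p.2.1, p.2.2.1),
      ∑ t ∈ Finset.range (2 * G + 1), Finsupp.single t (extendExp p.2.2.2.1 t)) 1 := by
    rintro ⟨a, b, c, n, hn⟩
    have hev : evalSnd (Finsupp.single 0 1) (φ (bas k q G ⟨a, b, c, n, hn⟩)) =
        (jordanX₁ k ^ (a : ℕ) * (jordanX₂ k * jordanX₁ k + jordanX₁ k * jordanX₂ k) ^ b *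
          jordanX₂ k ^ c) ⊗ₜ[k] Finsupp.single
            (0 + ∑ t ∈ Finset.range (2 * G + 1), Finsupp.single t (extendExp n t)) (1 : k) := by
      have hd := map_descProd φ.toRingHom.toMonoidHom
        (fun t => RingQuot.mkAlgHom k (lstrRel k q G) (z k q t)) (2 * G + 1) (extendExp n)
      have hφ : (fun t => φ.toRingHom.toMonoidHom (RingQuot.mkAlgHom k (lstrRel k q G) (z k q t))) =
          fun t => 1 ⊗ₜ[k] MulOpposite.op (ghostOp q G t) := funext hz
      rw [hφ] at hd
      rw [bas_eq, map_mul φ, map_mul φ, map_mul φ, map_pow φ, map_pow φ, map_pow φ, map_add φ,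
        map_mul φ, map_mul φ, h0, h1, h21]
      refine (congrArg (fun y => evalSnd _ (_ * y)) hd).trans ?_
      refine evalSnd_descProd le_rfl _ _ (fun t ht ht' => ?_) 0 (fun _ _ => rfl) _ ?_
      · have := hn ⟨t, ht⟩ ht'
        simpa [extendExp, ht] using this
      · induction c with
        | zero =>
          have h1 : evalSnd (E := Module.End k ((Fin 2 × ℕ × ℕ) →₀ k))
              (Finsupp.single (0 : ℕ →₀ ℕ) (1 : k)) 1 = 1 ⊗ₜ[k] Finsupp.single 0 1 := by
            simp [evalSnd, Algebra.TensorProduct.one_def]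
          have hpow : ∀ j, (gradeOp q ^ j) (Finsupp.single (0 : ℕ →₀ ℕ) (1 : k)) =
              Finsupp.single 0 1 := fun j => by
            induction j with
            | zero => simp
            | succ j ih => rw [pow_succ, Module.End.mul_apply, hgrade, ih]
          rw [pow_zero, mul_one, pow_zero, mul_one, Algebra.TensorProduct.tmul_pow,
            Algebra.TensorProduct.tmul_pow, ← MulOpposite.op_mul, ← MulOpposite.op_pow,
            ← MulOpposite.op_pow, ← pow_two, ← pow_mul]
          have h2 := evalSnd_mul_tmul h1 (jordanX₁ k ^ (a : ℕ)) (gradeOp q ^ (a : ℕ))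
          rw [hpow, one_mul, one_mul] at h2
          rw [evalSnd_mul_tmul h2, hpow]
        | succ c ih =>
          rw [pow_succ, ← mul_assoc, mul_add, map_add, evalSnd_mul_tmul ih, evalSnd_mul_tmul ih,
            hgrade, hderiv, TensorProduct.tmul_zero, add_zero, mul_assoc, ← pow_succ]
    have := jordan_monomial_apply k a b c
    rw [hf]
    simp only [LinearMap.comp_apply, AlgHom.toLinearMap_apply, hev, TensorProduct.map_tmul,
      LinearEquiv.coe_coe, LinearMap.applyₗ_apply_apply, LinearMap.id_apply]
    rw [this, finsuppTensorFinsupp'_single_tmul_single, zero_add, mul_one]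
  refine LinearIndependent.of_comp f ?_
  have hcomp : f ∘ bas k q G = (fun i => Finsupp.single i (1 : k)) ∘ fun p =>
      ((p.1, p.2.1, p.2.2.1),
        ∑ t ∈ Finset.range (2 * G + 1), Finsupp.single t (extendExp p.2.2.2.1 t)) := funext key
  rw [hcomp]
  refine (Finsupp.linearIndependent_single_one k _).comp _ ?_
  rintro ⟨a, b, c, n, hn⟩ ⟨a', b', c', n', hn'⟩ hpp
  simp only [Prod.mk.injEq] at hpp
  obtain ⟨⟨rfl, rfl, rfl⟩, hs⟩ := hpp
  have : n = n' := by
    funext t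
    have := DFunLike.congr_fun hs (t : ℕ)
    have ht : (t : ℕ) ≤ 2 * G := by omega
    simpa [Finsupp.finsetSum_apply, Finsupp.single_apply, extendExp_val, ht] using this
  subst this
  rfl

end Independence

section Growth

open Filter Topology

theorem tendsto_log_mul_pow_div_log {C : ℝ} (hC : 0 < C) (d : ℕ) :
    Tendsto (fun n : ℕ => ENNReal.ofReal (Real.log (C * (n : ℝ) ^ d) / Real.log n)) atTop
      (𝓝 (d : ℝ≥0∞)) := by
  have hlog : Tendsto (fun n : ℕ => Real.log n) atTop atTop :=
    Real.tendsto_log_atTop.comp tendsto_natCast_atTop_atTop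
  have h : Tendsto (fun n : ℕ => Real.log C / Real.log n + d) atTop (𝓝 (0 + d)) :=
    (tendsto_const_nhds.div_atTop hlog).add tendsto_const_nhds
  rw [zero_add] at h
  rw [← ENNReal.ofReal_natCast]
  refine ENNReal.tendsto_ofReal (h.congr' ?_)
  filter_upwards [eventually_ge_atTop 2] with n hn
  have h2 : (2 : ℝ) ≤ n := by exact_mod_cast hn
  have hpos : 0 < Real.log n := Real.log_pos (by linarith)
  rw [Real.log_mul hC.ne' (by positivity), Real.log_pow]
  field_simp

variable {k A : Type*} [Field k] [Ring A] [Algebra k A]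

theorem GKdim_le (d : ℕ) (h : ∀ (V : Submodule k A) [FiniteDimensional k V], ∃ C : ℕ, 0 < C ∧
    ∀ n, 0 < n → Module.finrank k ↥(∑ j ∈ Finset.range (n + 1), V ^ j) ≤ C * n ^ d) :
    GKdim k A ≤ d := by
  refine iSup₂_le fun V hV => ?_
  obtain ⟨C, hC, hle⟩ := h V
  rw [← (tendsto_log_mul_pow_div_log (C := C) (by exact_mod_cast hC) d).limsup_eq]
  refine limsup_le_limsup ?_
  filter_upwards [eventually_ge_atTop 1] with n hn
  refine ENNReal.ofReal_le_ofReal ?_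
  have h1 : (1 : ℝ) ≤ n := by exact_mod_cast hn
  refine div_le_div_of_nonneg_right ?_ (Real.log_nonneg h1)
  have hb : (Module.finrank k ↥(∑ j ∈ Finset.range (n + 1), V ^ j) : ℝ) ≤ C * (n : ℝ) ^ d := by
    exact_mod_cast hle n hn
  rcases Nat.eq_zero_or_pos (Module.finrank k ↥(∑ j ∈ Finset.range (n + 1), V ^ j)) with h0 | h0
  · rw [h0, Nat.cast_zero, Real.log_zero]
    refine Real.log_nonneg ?_
    exact_mod_cast Nat.mul_pos hC (pow_pos hn d)
  · exact Real.log_le_log (by exact_mod_cast h0) hb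

theorem le_GKdim (d : ℕ) (V : Submodule k A) [hV : FiniteDimensional k V] {c : ℝ} (hc : 0 < c)
    (h : ∀ᶠ n : ℕ in atTop, c * (n : ℝ) ^ d ≤
      Module.finrank k ↥(∑ j ∈ Finset.range (n + 1), V ^ j)) :
    (d : ℝ≥0∞) ≤ GKdim k A := by
  refine le_trans ?_ (le_iSup₂_of_le V hV le_rfl)
  rw [← (tendsto_log_mul_pow_div_log hc d).limsup_eq]
  refine limsup_le_limsup ?_
  filter_upwards [eventually_ge_atTop 1, h] with n hn hle
  have h1 : (1 : ℝ) ≤ n := by exact_mod_cast hn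
  exact ENNReal.ofReal_le_ofReal (div_le_div_of_nonneg_right
    (Real.log_le_log (by positivity) hle) (Real.log_nonneg h1))

theorem exists_sum_pow_le {B : ℕ → Submodule k A} (hB : Monotone B) (h1 : 1 ∈ B 0)
    (h : ∀ a, ∃ d, ∀ N, ∀ v ∈ B N, a * v ∈ B (N + d)) (V : Submodule k A)
    [FiniteDimensional k V] :
    ∃ d, ∀ n, ∑ j ∈ Finset.range (n + 1), V ^ j ≤ B (n * d) := by
  choose d hd using h
  obtain ⟨S, hS⟩ : V.FG := Module.Finite.iff_fg.mp inferInstance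
  have hmul : ∀ N, V * B N ≤ B (N + S.sup d) := fun N => by
    refine Submodule.mul_le.mpr fun a ha v hv => ?_
    rw [← hS] at ha
    refine Submodule.span_le (p := (B (N + S.sup d)).comap (LinearMap.mulRight k v)) |>.mpr
      (fun s hs => ?_) ha
    exact hB (Nat.add_le_add_left (Finset.le_sup hs) N) (hd s N v hv)
  have hpow : ∀ j, V ^ j ≤ B (j * S.sup d) := fun j => by
    induction j with
    | zero => simpa [Submodule.one_le] using h1
    | succ j ih =>
      rw [pow_succ', Nat.succ_mul]
      exact (mul_le_mul_right ih _).trans (hmul _)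
  refine ⟨S.sup d, fun n => ?_⟩
  refine Finset.sum_induction _ (· ≤ B (n * S.sup d)) (fun _ _ => sup_le) bot_le
    fun j hj => (hpow j).trans (hB (Nat.mul_le_mul_right _ ?_))
  exact Nat.lt_succ_iff.mp (Finset.mem_range.mp hj)

theorem descProd_mem_pow {W : Submodule k A} (h1 : 1 ≤ W) {Z : ℕ → A} {N : ℕ} {n : ℕ → ℕ} {m : ℕ}
    (hZ : ∀ t < m, Z t ∈ W) (hn : ∀ t < m, n t ≤ N) : descProd Z m n ∈ W ^ (m * N) := by
  induction m with
  | zero => simpa [descProd] using Submodule.one_le.mp (le_refl (1 : Submodule k A))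
  | succ m ih =>
    rw [Nat.succ_mul, add_comm, pow_add]
    exact Submodule.mul_mem_mul
      (pow_le_pow_right₀ h1 (hn m (by omega)) (Submodule.pow_mem_pow _ (hZ m (by omega)) _))
      (ih (fun t ht => hZ t (by omega)) fun t ht => hn t (by omega))

end Growth

section Basis

variable {k : Type*} [Field k]

/-- The indices of the PBW monomials whose exponents of `x₂₁`, `x₂` and the even-indexed `z`'s are
at most `N`. -/
def pbwIndex (G N : ℕ) (p : Fin 2 × Fin (N + 1) × Fin (N + 1) × (Fin G → Fin 2) ×
    (Fin (G + 1) → Fin (N + 1))) : Fin 2 × ℕ × ℕ ×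
      {n : Fin (2 * G + 1) → ℕ // ∀ t : Fin (2 * G + 1), (t : ℕ) % 2 = 1 → n t ≤ 1} :=
  ⟨p.1, p.2.1, p.2.2.1, fun t =>
    if h : (t : ℕ) % 2 = 1 then p.2.2.2.1 ⟨t / 2, by omega⟩ else p.2.2.2.2 ⟨t / 2, by omega⟩,
    fun t ht => by
      simp only [ht, dite_true]
      omega⟩

theorem pbwIndex_injective (G N : ℕ) : Function.Injective (pbwIndex G N) := by
  rintro ⟨a, b, c, o, e⟩ ⟨a', b', c', o', e'⟩ h
  simp only [pbwIndex, Prod.mk.injEq, Subtype.mk.injEq] at h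
  obtain ⟨rfl, hb, hc, hn⟩ := h
  have ho : o = o' := funext fun i => by
    have := congrFun hn ⟨2 * i + 1, by omega⟩
    simpa [show (2 * (i : ℕ) + 1) % 2 = 1 by omega, show (2 * (i : ℕ) + 1) / 2 = i by omega,
      ← Fin.ext_iff] using this
  have he : e = e' := funext fun i => by
    have := congrFun hn ⟨2 * i, by omega⟩
    simpa [← Fin.ext_iff] using this
  rw [Fin.ext hb, Fin.ext hc, ho, he]

theorem card_pbwIndex_source (G N : ℕ) : Fintype.card (Fin 2 × Fin (N + 1) × Fin (N + 1) ×
    (Fin G → Fin 2) × (Fin (G + 1) → Fin (N + 1))) = 2 ^ (G + 1) * (N + 1) ^ (G + 3) := by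
  simp only [Fintype.card_prod, Fintype.card_fin, Fintype.card_fun]
  ring

variable (q : k) (G : ℕ)

/-- The filtration of `B(lstr₋(1,G))` by the exponents of `x₂₁`, `x₂` and the even-indexed
`z`'s. -/
noncomputable abbrev pbwSpan (N : ℕ) : Submodule k (RingQuot (lstrRel k q G)) :=
  boxSpan k G (RingQuot.mkAlgHom k (lstrRel k q G) (X k 0))
    (RingQuot.mkAlgHom k (lstrRel k q G) (X k 1))
    (fun t => RingQuot.mkAlgHom k (lstrRel k q G) (z k q t)) N

theorem pbwSpan_le (N : ℕ) :
    pbwSpan q G N ≤ Submodule.span k (Set.range (bas k q G ∘ pbwIndex G N)) := by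
  refine (isLstr_ringQuot q G).boxSpan_le fun a b c n ha hb hc hn hn' => ?_
  refine Submodule.subset_span ⟨⟨⟨a, by omega⟩, ⟨b, by omega⟩, ⟨c, by omega⟩,
    fun i => ⟨n (2 * i + 1), ?_⟩, fun i => ⟨n (2 * i), ?_⟩⟩, ?_⟩
  · exact Nat.lt_succ_iff.mpr (hn' _ (by omega) (by omega))
  · exact Nat.lt_succ_iff.mpr (hn _ (by omega))
  · rw [Function.comp_apply, bas_eq]
    refine congrArg _ (descProd_congr _ fun t ht => ?_)
    simp only [extendExp, ht, dite_true, pbwIndex]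
    split_ifs with h
    · exact congrArg n (by omega)
    · exact congrArg n (by omega)

variable {q}

theorem exists_mul_mem_pbwSpan [CharZero k] (hq : q ≠ 0) (a : RingQuot (lstrRel k q G)) :
    ∃ d, ∀ N, ∀ v ∈ pbwSpan q G N, a * v ∈ pbwSpan q G (N + d) := by
  have h := isLstr_ringQuot q G
  obtain ⟨a, rfl⟩ := RingQuot.mkAlgHom_surjective k (lstrRel k q G) a
  induction a using FreeAlgebra.induction with
  | grade0 r =>
    refine ⟨0, fun N v hv => ?_⟩
    rw [AlgHom.commutes, ← Algebra.smul_def]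
    exact Submodule.smul_mem _ _ hv
  | grade1 i =>
    refine ⟨1, fun N v hv => ?_⟩
    match i with
    | 0 => exact IsLstr.x₁_mul_mem hv
    | 1 => exact h.x₂_mul_mem hv
    | 2 => exact h.z_mul_mem hq 0 hv
  | mul a b ha hb =>
    obtain ⟨d, hd⟩ := ha
    obtain ⟨e, he⟩ := hb
    refine ⟨e + d, fun N v hv => ?_⟩
    rw [map_mul, mul_assoc, ← add_assoc]
    exact hd _ _ (he _ _ hv)
  | add a b ha hb =>
    obtain ⟨d, hd⟩ := ha
    obtain ⟨e, he⟩ := hb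
    refine ⟨d + e, fun N v hv => ?_⟩
    rw [map_add, add_mul]
    exact Submodule.add_mem _ (boxSpan_mono (by omega) (hd _ _ hv))
      (boxSpan_mono (by omega) (he _ _ hv))

theorem span_range_bas [CharZero k] (hq : q ≠ 0) :
    Submodule.span k (Set.range (bas k q G)) = ⊤ := by
  refine Submodule.eq_top_iff'.mpr fun a => ?_
  obtain ⟨d, hd⟩ := exists_mul_mem_pbwSpan G hq a
  have := pbwSpan_le q G _ (hd 0 1 (one_mem_boxSpan 0))
  rw [mul_one] at this
  exact Submodule.span_mono (Set.range_comp_subset_range _ _) this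

theorem GKdim_ringQuot_le [CharZero k] (hq : q ≠ 0) :
    GKdim k (RingQuot (lstrRel k q G)) ≤ (G + 3 : ℕ) := by
  refine GKdim_le _ fun V _ => ?_
  obtain ⟨d, hd⟩ := exists_sum_pow_le boxSpan_mono (one_mem_boxSpan 0)
    (exists_mul_mem_pbwSpan G hq) V
  refine ⟨2 ^ (G + 1) * (d + 1) ^ (G + 3), by positivity, fun n hn => ?_⟩
  have hfin := FiniteDimensional.span_of_finite k
    (Set.finite_range (bas k q G ∘ pbwIndex G (n * d)))
  have := Submodule.finrank_mono ((hd n).trans (pbwSpan_le q G _))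
  refine this.trans ((finrank_range_le_card _).trans ?_)
  rw [card_pbwIndex_source, mul_assoc, ← mul_pow]
  refine Nat.mul_le_mul_left _ (Nat.pow_le_pow_left ?_ _)
  nlinarith

theorem le_GKdim_ringQuot (hq : q ≠ 0) :
    (G + 3 : ℕ) ≤ GKdim k (RingQuot (lstrRel k q G)) := by
  obtain ⟨x₁, hx₁⟩ : ∃ x, x = RingQuot.mkAlgHom k (lstrRel k q G) (X k 0) := ⟨_, rfl⟩
  obtain ⟨x₂, hx₂⟩ : ∃ x, x = RingQuot.mkAlgHom k (lstrRel k q G) (X k 1) := ⟨_, rfl⟩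
  obtain ⟨Z, hZ⟩ : ∃ Z, Z = fun t => RingQuot.mkAlgHom k (lstrRel k q G) (z k q t) := ⟨_, rfl⟩
  obtain ⟨S, hS⟩ : ∃ S, S = ({1, x₁, x₂ * x₁ + x₁ * x₂, x₂} ∪ Z '' Set.Iio (2 * G + 1) :
    Set (RingQuot (lstrRel k q G))) := ⟨_, rfl⟩
  have hfin : S.Finite := by
    rw [hS]
    exact (Set.toFinite _).union ((Set.finite_Iio _).image _)
  have : FiniteDimensional k (Submodule.span k S) := FiniteDimensional.span_of_finite k hfin
  have hsub : ∀ s ∈ S, s ∈ Submodule.span k S := fun s hs => Submodule.subset_span hs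
  have h1 : 1 ≤ Submodule.span k S := Submodule.one_le.mpr (hsub _ (by simp [hS]))
  have hmem : ∀ N p, bas k q G (pbwIndex G N p) ∈
      Submodule.span k S ^ ((2 * G + 4) * (N + 1)) := by
    intro N p
    have hpow : ∀ s ∈ S, ∀ i ≤ N + 1, s ^ i ∈ Submodule.span k S ^ (N + 1) := fun s hs i hi =>
      pow_le_pow_right₀ h1 hi (Submodule.pow_mem_pow _ (hsub s hs) _)
    rw [bas_eq, ← hx₁, ← hx₂, ← hZ, show (2 * G + 4) * (N + 1) =
      N + 1 + (N + 1) + (N + 1) + (2 * G + 1) * (N + 1) by ring, pow_add, pow_add, pow_add]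
    refine Submodule.mul_mem_mul (Submodule.mul_mem_mul (Submodule.mul_mem_mul
      (hpow _ (by simp [hS]) _ ?_) (hpow _ (by simp [hS]) _ ?_)) (hpow _ (by simp [hS]) _ ?_))
      (descProd_mem_pow h1 (fun t ht => hsub _ ?_) fun t ht => ?_)
    · have := p.1.2
      simp only [pbwIndex]
      omega
    · exact p.2.1.2.le
    · exact p.2.2.1.2.le
    · rw [hS]
      exact Or.inr ⟨t, ht, rfl⟩
    · simp only [extendExp, ht, dite_true, pbwIndex]
      split_ifs <;> omega
  have hrank : ∀ N n, (2 * G + 4) * (N + 1) ≤ n → (N + 1) ^ (G + 3) ≤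
      Module.finrank k ↥(∑ j ∈ Finset.range (n + 1), Submodule.span k S ^ j) := by
    intro N n hn
    have hfd : FiniteDimensional k ↥(∑ j ∈ Finset.range (n + 1), Submodule.span k S ^ j) := by
      have hf : ∀ j, FiniteDimensional k ↥(Submodule.span k S ^ j) := fun j =>
        Module.Finite.iff_fg.mpr ((Submodule.fg_span hfin).pow j)
      exact Finset.sum_induction _
        (fun U : Submodule k (RingQuot (lstrRel k q G)) => FiniteDimensional k ↥U)
        (fun U U' _ _ => Submodule.finiteDimensional_sup U U') (finiteDimensional_bot k _)
        fun j _ => hf j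
    have hle : Submodule.span k (Set.range (bas k q G ∘ pbwIndex G N)) ≤
        ∑ j ∈ Finset.range (n + 1), Submodule.span k S ^ j := by
      refine Submodule.span_le.mpr ?_
      rintro _ ⟨p, rfl⟩
      have hn' : Submodule.span k S ^ n ≤ ∑ j ∈ Finset.range (n + 1), Submodule.span k S ^ j := by
        rw [Finset.sum_range_succ]
        exact le_sup_right
      exact hn'
        (pow_le_pow_right₀ h1 hn (hmem N p))
    have := Submodule.finrank_mono hle
    rw [finrank_span_eq_card ((linearIndependent_bas hq G).comp _ (pbwIndex_injective G N)),
      card_pbwIndex_source] at this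
    exact (Nat.le_mul_of_pos_left _ (by positivity)).trans this
  refine le_GKdim _ (Submodule.span k S) (c := (1 / (2 * (2 * G + 4)) : ℝ) ^ (G + 3))
    (by positivity) ?_
  filter_upwards [Filter.eventually_ge_atTop (2 * G + 4)] with n hn
  have hdiv : 1 ≤ n / (2 * G + 4) := (Nat.one_le_div_iff (by omega)).mpr hn
  obtain ⟨N, hN⟩ := Nat.exists_eq_add_of_le' hdiv
  have hlow : (2 * G + 4) * (N + 1) ≤ n := hN ▸ Nat.mul_div_le n _
  have hupp : n < (2 * G + 4) * (N + 1 + 1) := hN ▸ Nat.lt_mul_div_succ n (by omega)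
  have hN1 : (1 / (2 * (2 * G + 4)) : ℝ) * n ≤ (N + 1 : ℕ) := by
    have : (n : ℝ) ≤ (2 * (2 * G + 4)) * (N + 1 : ℕ) := by
      exact_mod_cast (show n ≤ (2 * (2 * G + 4)) * (N + 1) by nlinarith)
    rw [one_div, inv_mul_le_iff₀ (by positivity)]
    exact this
  rw [← mul_pow]
  refine (pow_le_pow_left₀ (by positivity) hN1 _).trans ?_
  exact_mod_cast hrank N n hlow

end Basis

/-- The PBW monomials form a basis of `B(lstr₋(1,G))`, and
`GKdim B(lstr₋(1,G)) = G + 3`. -/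
theorem statement11 (k : Type*) [Field k] [IsAlgClosed k] [CharZero k]
    (q : k) (hq : q ≠ 0) (G : ℕ) (hG : 1 ≤ G) :
    (LinearIndependent k (bas k q G) ∧
      Submodule.span k (Set.range (bas k q G)) = ⊤) ∧
    GKdim k (RingQuot (lstrRel k q G)) = (G : ℝ≥0∞) + 3 := by
  refine ⟨⟨linearIndependent_bas hq G, span_range_bas G hq⟩, ?_⟩
  have := le_antisymm (GKdim_ringQuot_le G hq) (le_GKdim_ringQuot G hq)
  rw [this]
  norm_cast
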